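/- For every graph G it holds that tctw(G) = tctw'(G). Moreover, for every tree-cut decomposition T of G one has width(T) ≤ width'(T), and given a tree-cut decomposition T = (T, X) of G, a tree-cut decomposition T' with width'(T') ≤ width(T) can be computed in time O(‖G‖ · |G|² · width(T)). -/

import Mathlib

open Classical

attribute [local instance] Classical.propDecidable

noncomputable section

/-- A finite multigraph without loops: finitely many vertices, finitely many
edges (parallel edges are allowed since `E` is an abstract edge type),
each edge having two distinct endpoints. -/
structure Multigraph : Type 1 where
  V : Type
  E : Type
  fintypeV : Fintype V
  fintypeE : Fintype E
  ends : E → Sym2 V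
  loopless : ∀ e : E, ¬ (ends e).IsDiag

attribute [instance] Multigraph.fintypeV Multigraph.fintypeE

theorem sym2_map_not_isDiag {α β : Type} {f : α → β} (hf : Function.Injective f) :
    ∀ {p : Sym2 α}, ¬ p.IsDiag → ¬ (p.map f).IsDiag := by
  intro p
  induction p using Sym2.ind with
  | _ x y =>
    intro hp h
    rw [Sym2.map_pair_eq, Sym2.mk_isDiag_iff] at h
    exact hp (by rw [Sym2.mk_isDiag_iff]; exact hf h)

theorem sym2_isDiag_of_map {α β : Type} (f : α → β) (p : Sym2 α)
    (hinj : ∀ x ∈ p, ∀ y ∈ p, f x = f y → x = y)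
    (h : (p.map f).IsDiag) : p.IsDiag := by
  induction p using Sym2.ind with
  | _ a b =>
    rw [Sym2.map_pair_eq, Sym2.mk_isDiag_iff] at h
    rw [Sym2.mk_isDiag_iff]
    exact hinj a (Sym2.mem_mk_left a b) b (Sym2.mem_mk_right a b) h

namespace Multigraph

/-- `|G|`: the number of vertices of `G`. -/
def numVerts (G : Multigraph) : ℕ := Fintype.card G.V

/-- `‖G‖`: the number of edges of `G` (with multiplicities). -/
def numEdges (G : Multigraph) : ℕ := Fintype.card G.E

/-- The degree of a vertex: the number of incident edges. -/
def degree (G : Multigraph) (v : G.V) : ℕ := {e : G.E | v ∈ G.ends e}.ncard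

/-- A graph is subcubic if every vertex has degree at most `3`. -/
def Subcubic (G : Multigraph) : Prop := ∀ v : G.V, G.degree v ≤ 3

/-- The graph `G - D` obtained by deleting the set `D` of edges. -/
def deleteEdges (G : Multigraph) (D : Finset G.E) : Multigraph where
  V := G.V
  E := {e : G.E // e ∉ D}
  fintypeV := G.fintypeV
  fintypeE := Fintype.ofFinite _
  ends := fun e => G.ends e.1
  loopless := fun e => G.loopless e.1

/-- Walks in a multigraph, recorded as sequences of edges together with
compatible endpoints. -/
inductive Walk (G : Multigraph) : G.V → G.V → Type
  | nil (v : G.V) : Walk G v v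
  | cons {u v w : G.V} (e : G.E) (h : G.ends e = s(u, v)) (p : Walk G v w) : Walk G u w

/-- The list of edges traversed by a walk. -/
def Walk.edges {G : Multigraph} : {u v : G.V} → Walk G u v → List G.E
  | _, _, .nil _ => []
  | _, _, .cons e _ p => e :: p.edges

/-- The list of vertices visited by a walk. -/
def Walk.support {G : Multigraph} : {u v : G.V} → Walk G u v → List G.V
  | u, _, .nil _ => [u]
  | u, _, .cons _ _ p => u :: p.support

/-- A walk is a path if it has no repeated vertices. -/
def Walk.IsPath {G : Multigraph} {u v : G.V} (p : Walk G u v) : Prop := p.support.Nodup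

def Reachable (G : Multigraph) (u v : G.V) : Prop := Nonempty (Walk G u v)

/-- A multigraph is connected if it is nonempty and every two vertices are
joined by a walk. -/
def Connected (G : Multigraph) : Prop := Nonempty G.V ∧ ∀ u v : G.V, G.Reachable u v

/-- The vertex set of the connected component of `v`. -/
def component (G : Multigraph) (v : G.V) : Set G.V := {u | G.Reachable u v}

/-- Reachability inside a set `S` of vertices, i.e. reachability in `G[S]`. -/
def ReachIn (G : Multigraph) (S : Set G.V) (u v : G.V) : Prop :=
  ∃ p : Walk G u v, ∀ x ∈ p.support, x ∈ S

/-- The induced subgraph `G[S]` is connected. -/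
def ConnectedOn (G : Multigraph) (S : Set G.V) : Prop :=
  ∀ u ∈ S, ∀ v ∈ S, G.ReachIn S u v

/-- The number of connected components of the induced subgraph `G[S]`, expressed
as the maximum size of a family of vertices of `S` that are pairwise
non-connected within `S`. -/
def compCount (G : Multigraph) (S : Set G.V) : ℕ :=
  sSup {n | ∃ f : Fin n → G.V, (∀ i, f i ∈ S) ∧
    ∀ i j, i ≠ j → ¬ G.ReachIn S (f i) (f j)}

/-- The set of edges of the induced subgraph `G[X]`. -/
def inducedEdges (G : Multigraph) (X : Set G.V) : Set G.E :=
  {e | ∀ v ∈ G.ends e, v ∈ X}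

/-- The edge boundary `δ(X)`: edges with exactly one endpoint in `X`. -/
def edgeBoundary (G : Multigraph) (X : Set G.V) : Set G.E :=
  {e | ∃ u v : G.V, G.ends e = s(u, v) ∧ u ∈ X ∧ v ∉ X}

/-- The (open) neighbourhood `N(S)`. -/
def nbhd (G : Multigraph) (S : Set G.V) : Set G.V :=
  {u | u ∉ S ∧ ∃ (e : G.E) (v : G.V), v ∈ S ∧ G.ends e = s(u, v)}

/-- All parallel edges between `u` and `v`. -/
def parallelEdges (G : Multigraph) (u v : G.V) : Set G.E := {e | G.ends e = s(u, v)}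

/-- Planarity of a multigraph, via a topological embedding in the plane:
vertices map injectively to points, edges map to arcs between the images of
their endpoints, and two arcs may only meet at images of common endpoints. -/
def Planar (G : Multigraph) : Prop :=
  ∃ f : G.V → ℝ × ℝ, Function.Injective f ∧
    ∃ γ : G.E → ℝ → ℝ × ℝ,
      (∀ e, ContinuousOn (γ e) (Set.Icc 0 1)) ∧
      (∀ e, Set.InjOn (γ e) (Set.Icc 0 1)) ∧
      (∀ e, ∃ u v : G.V, G.ends e = s(u, v) ∧ γ e 0 = f u ∧ γ e 1 = f v) ∧
      (∀ (e : G.E) (v : G.V), f v ∈ γ e '' Set.Icc 0 1 → v ∈ G.ends e) ∧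
      (∀ e e' : G.E, e ≠ e' →
        ∀ pt ∈ γ e '' Set.Icc 0 1 ∩ γ e' '' Set.Icc 0 1, ∃ v : G.V, pt = f v)

/-- The disjoint union `G ⊎ H` of two multigraphs. -/
def disjUnion (G H : Multigraph) : Multigraph where
  V := G.V ⊕ H.V
  E := G.E ⊕ H.E
  fintypeV := Fintype.ofFinite _
  fintypeE := Fintype.ofFinite _
  ends := Sum.elim (fun e => (G.ends e).map Sum.inl) (fun e => (H.ends e).map Sum.inr)
  loopless := by
    rintro (e | e) h
    · exact sym2_map_not_isDiag Sum.inl_injective (G.loopless e) h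
    · exact sym2_map_not_isDiag Sum.inr_injective (H.loopless e) h

/-- The induced subgraph `G[S]` (equivalently, `G` with the vertices outside
`S` deleted). -/
def induce (G : Multigraph) (S : Set G.V) : Multigraph where
  V := ↥S
  E := {e : G.E // ∀ v ∈ G.ends e, v ∈ S}
  fintypeV := Fintype.ofFinite _
  fintypeE := Fintype.ofFinite _
  ends := fun e =>
    Sym2.map (fun a => if ha : a ∈ S then (⟨a, ha⟩ : ↥S)
      else ⟨(Quot.out (G.ends e.1)).1, e.2 _ (Sym2.out_fst_mem _)⟩) (G.ends e.1)
  loopless := by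
    intro e h
    apply G.loopless e.1
    refine sym2_isDiag_of_map _ _ (fun x hx' y hy' hf => ?_) h
    have hx : x ∈ S := e.2 x hx'
    have hy : y ∈ S := e.2 y hy'
    simp only [dif_pos hx, dif_pos hy] at hf
    exact congrArg Subtype.val hf

/-- Build a multigraph from a simple graph. -/
def ofSimple {V : Type} [Fintype V] (G : SimpleGraph V) : Multigraph where
  V := V
  E := G.edgeSet
  fintypeV := ‹Fintype V›
  fintypeE := Fintype.ofFinite _
  ends := Subtype.val
  loopless := fun e => SimpleGraph.not_isDiag_of_mem_edgeSet G e.2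

end Multigraph

open Multigraph

/-- An immersion of `H` into `G`: an injection on vertices together with
pairwise edge-disjoint paths in `G` joining the images of the endpoints of
the edges of `H`. -/
structure Immersion (H G : Multigraph) where
  vmap : H.V → G.V
  vmap_inj : Function.Injective vmap
  esrc : H.E → H.V
  etgt : H.E → H.V
  ends_eq : ∀ e : H.E, H.ends e = s(esrc e, etgt e)
  emap : (e : H.E) → Multigraph.Walk G (vmap (esrc e)) (vmap (etgt e))
  emap_path : ∀ e : H.E, (emap e).IsPath
  edge_disjoint : ∀ e e' : H.E, e ≠ e' → ∀ x : G.E, x ∈ (emap e).edges → x ∉ (emap e').edges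

/-- `G` contains `H` as an immersion. -/
def ContainsImm (G H : Multigraph) : Prop := Nonempty (Immersion H G)

/-- `G` is `F`-immersion-free. -/
def FFree {ι : Type} (F : ι → Multigraph) (G : Multigraph) : Prop :=
  ∀ i : ι, ¬ ContainsImm G (F i)

/-- The induced subgraph `G[X]` is `F`-immersion-free: there is no immersion
model of a member of `F` living entirely inside `X`. -/
def FFreeOn {ι : Type} (F : ι → Multigraph) (G : Multigraph) (X : Set G.V) : Prop :=
  ∀ i : ι, ¬ ∃ M : Immersion (F i) G, (∀ v, M.vmap v ∈ X) ∧
    ∀ (e : (F i).E), ∀ x ∈ (M.emap e).support, x ∈ X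

/-- `OPT_F(G)`: the minimum size of an edge set whose deletion makes `G`
`F`-immersion-free. -/
def OPT {ι : Type} (F : ι → Multigraph) (G : Multigraph) : ℕ :=
  sInf {k | ∃ D : Finset G.E, D.card = k ∧ FFree F (G.deleteEdges D)}

/-- `H` belongs to the immersion-obstruction set of the class `C`:
`H ∉ C` and every proper immersion of `H` belongs to `C`. -/
def InObsIm (C : Multigraph → Prop) (H : Multigraph) : Prop :=
  ¬ C H ∧ ∀ H' : Multigraph, ContainsImm H H' → ¬ ContainsImm H' H → C H'

/-- `MAX_F`: the maximum number of edges of a member of the family. -/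
def maxEdges {ι : Type} [Fintype ι] (F : ι → Multigraph) : ℕ :=
  Finset.univ.sup fun i => (F i).numEdges

/-- The underlying asymmetric adjacency relation of the `n × n` wall. -/
def wallRel (n : ℕ) (a b : Fin n × Fin (2 * n)) : Prop :=
  (a.1 = b.1 ∧ (a.2 : ℕ) + 1 = (b.2 : ℕ)) ∨
  (a.2 = b.2 ∧ (a.1 : ℕ) + 1 = (b.1 : ℕ) ∧ ((a.1 : ℕ) + (a.2 : ℕ)) % 2 = 0)

/-- The `n × n` wall graph `W_{n,n}`. -/
def Wall (n : ℕ) : Multigraph := Multigraph.ofSimple (SimpleGraph.fromRel (wallRel n))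

/-- A graph parameter is closed under immersions. -/
def ImmersionClosed (p : Multigraph → ℕ) : Prop :=
  ∀ G H : Multigraph, ContainsImm G H → p H ≤ p G

/-- A graph parameter is closed under disjoint unions. -/
def DisjUnionClosed (p : Multigraph → ℕ) : Prop :=
  ∀ G H : Multigraph, p (G.disjUnion H) = max (p G) (p H)

/-- A graph parameter is large on walls. -/
def LargeOnWalls (p : Multigraph → ℕ) : Prop :=
  (Set.range fun n : ℕ => p (Wall n)).Infinite

/-- The parameter `p_r`: the minimum number of edge deletions needed to bring
the value of `p` down to at most `r`. -/
def pAtMost (p : Multigraph → ℕ) (r : ℕ) (G : Multigraph) : ℕ :=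
  sInf {k | ∃ S : Finset G.E, S.card ≤ k ∧ p (G.deleteEdges S) ≤ r}

/-- A tree-cut decomposition of `G`: a forest `T` on node set `N` together with
a near-partition of `V(G)` into bags, such that the trees of the forest
correspond exactly to the connected components of `G`. -/
structure TreeCutDecomp (G : Multigraph) : Type 1 where
  N : Type
  fintypeN : Fintype N
  T : SimpleGraph N
  acyclic : T.IsAcyclic
  bag : N → Finset G.V
  nodeOf : G.V → N
  mem_bag : ∀ v : G.V, v ∈ bag (nodeOf v)
  bag_disjoint : ∀ t t' : N, t ≠ t' → Disjoint (bag t) (bag t')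
  comp_compat : ∀ u v : G.V, G.Reachable u v ↔ T.Reachable (nodeOf u) (nodeOf v)
  trees_used : ∀ t : N, ∃ v : G.V, T.Reachable t (nodeOf v)

attribute [instance] TreeCutDecomp.fintypeN

/-- A multigraph with a marked set of core vertices; the remaining vertices
are peripheral.  (Used for torsos and 3-centers.) -/
structure MarkedGraph : Type 1 where
  G : Multigraph
  core : Set G.V

/-- The vertex `z` has exactly two incident edges, one to `a` and one to `b`. -/
def SuppPair (G : Multigraph) (z a b : G.V) : Prop :=
  ∃ e1 e2 : G.E, e1 ≠ e2 ∧ G.ends e1 = s(z, a) ∧ G.ends e2 = s(z, b) ∧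
    ∀ e : G.E, z ∈ G.ends e → e = e1 ∨ e = e2

/-- `M'` is obtained from `M` by suppressing one peripheral vertex of degree at
most two (deleting any resulting loop). -/
def Suppresses (M M' : MarkedGraph) : Prop :=
  ∃ z : M.G.V, z ∉ M.core ∧ M.G.degree z ≤ 2 ∧
    ∃ fV : M'.G.V ≃ {v : M.G.V // v ≠ z},
      (∀ w : M'.G.V, w ∈ M'.core ↔ (fV w).1 ∈ M.core) ∧
      ((¬ (∃ a b : M.G.V, a ≠ b ∧ SuppPair M.G z a b) ∧
          ∃ fE : M'.G.E ≃ {e : M.G.E // z ∉ M.G.ends e},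
            ∀ e : M'.G.E, Sym2.map (fun w => (fV w).1) (M'.G.ends e) = M.G.ends (fE e).1) ∨
        (∃ a b : M.G.V, a ≠ b ∧ SuppPair M.G z a b ∧
          ∃ fE : M'.G.E ≃ ({e : M.G.E // z ∉ M.G.ends e} ⊕ Unit),
            ∀ e : M'.G.E, Sym2.map (fun w => (fV w).1) (M'.G.ends e) =
              Sum.elim (fun e' : {e : M.G.E // z ∉ M.G.ends e} => M.G.ends e'.1)
                (fun _ => s(a, b)) (fE e)))

/-- No peripheral vertex can be suppressed any more. -/
def MarkedGraph.Terminal (M : MarkedGraph) : Prop :=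
  ∀ z : M.G.V, z ∉ M.core → 2 < M.G.degree z

namespace TreeCutDecomp

variable {G : Multigraph}

/-- `X_{T_{ab}}`: the union of the bags on the side of `a` of the tree edge `ab`. -/
def side (D : TreeCutDecomp G) (a b : D.N) : Set G.V :=
  {v | (D.T.deleteEdges {s(a, b)}).Reachable (D.nodeOf v) a}

/-- The adhesion of the tree edge `ab`: the edges of `G` crossing between the
two sides. -/
def adh (D : TreeCutDecomp G) (a b : D.N) : Set G.E :=
  {e | ∃ u v : G.V, G.ends e = s(u, v) ∧ u ∈ D.side a b ∧ v ∈ D.side b a}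

/-- `w(t) = |X_t| + #{neighbours with bold adhesion}`. -/
def wval (D : TreeCutDecomp G) (t : D.N) : ℕ :=
  (D.bag t).card + {t' : D.N | D.T.Adj t t' ∧ 2 < (D.adh t t').ncard}.ncard

/-- The maximum adhesion size of the decomposition. -/
def maxAdh (D : TreeCutDecomp G) : ℕ :=
  Finset.univ.sup fun pq : D.N × D.N =>
    if D.T.Adj pq.1 pq.2 then (D.adh pq.1 pq.2).ncard else 0

/-- `width'` of a tree-cut decomposition. -/
def width' (D : TreeCutDecomp G) : ℕ :=
  max D.maxAdh (Finset.univ.sup fun t => D.wval t)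

/-- `z(t) = |X_t| + Σ_{e ∋ t, |adh(e)| ≥ 3} |adh(e)|`. -/
def zval (D : TreeCutDecomp G) (t : D.N) : ℕ :=
  (D.bag t).card + ∑ t' : D.N,
    if D.T.Adj t t' ∧ 3 ≤ (D.adh t t').ncard then (D.adh t t').ncard else 0

/-- `width''` of a tree-cut decomposition. -/
def width'' (D : TreeCutDecomp G) : ℕ := Finset.univ.sup fun t => D.zval t

/-- A tree-cut decomposition is connected if both sides of every tree edge
induce connected subgraphs of `G`. -/
def IsConnectedDecomp (D : TreeCutDecomp G) : Prop :=
  ∀ a b : D.N, D.T.Adj a b → G.ConnectedOn (D.side a b) ∧ G.ConnectedOn (D.side b a)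

/-- The vertex type of the torso at `t`: the core vertices (the bag at `t`)
together with one peripheral vertex for each component of `T - t` inside the
tree of `t` (equivalently, for each neighbour of `t`). -/
def TorsoV (D : TreeCutDecomp G) (t : D.N) : Type :=
  {v : G.V // v ∈ D.bag t} ⊕ {x : D.N // D.T.Adj t x}

/-- The projection of the vertices of `G` to the vertices of the torso at `t`
(defined on the connected component of `G` corresponding to the tree of `t`). -/
def torsoProj (D : TreeCutDecomp G) (t : D.N) (v : G.V) : Option (D.TorsoV t) :=
  if h : v ∈ D.bag t then some (Sum.inl ⟨v, h⟩)
  else if h2 : ∃ x : {x : D.N // D.T.Adj t x},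
      (D.T.deleteEdges {e : Sym2 D.N | t ∈ e}).Reachable (D.nodeOf v) x.1
    then some (Sum.inr h2.choose)
  else none

/-- The torso of the decomposition at the node `t` (as a multigraph): each
component of `T - t` is consolidated to a single peripheral vertex, and the
resulting loops are deleted. -/
instance instFintypeTorsoV (D : TreeCutDecomp G) (t : D.N) : Fintype (D.TorsoV t) := by
  unfold TorsoV; infer_instance

def torsoGraph (D : TreeCutDecomp G) (t : D.N) : Multigraph where
  V := D.TorsoV t
  E := {e : G.E // ∃ a b : D.TorsoV t, a ≠ b ∧
        Sym2.map (D.torsoProj t) (G.ends e) = s(some a, some b)}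
  fintypeV := inferInstance
  fintypeE := Fintype.ofFinite _
  ends := fun e => s(e.2.choose, e.2.choose_spec.choose)
  loopless := fun e hd => e.2.choose_spec.choose_spec.1 (Sym2.mk_isDiag_iff.mp hd)

/-- The torso at `t` as a marked graph: the core vertices are the vertices of
the bag at `t`. -/
def torso (D : TreeCutDecomp G) (t : D.N) : MarkedGraph where
  G := D.torsoGraph t
  core := Set.range (Sum.inl : {v : G.V // v ∈ D.bag t} → D.TorsoV t)

/-- The possible numbers of vertices of a 3-center at `t`: the sizes of the
terminal marked graphs obtained from the torso at `t` by exhaustively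
suppressing peripheral vertices of degree at most two. -/
def threeCenterSizes (D : TreeCutDecomp G) (t : D.N) : Set ℕ :=
  {n | ∃ M : MarkedGraph, Relation.ReflTransGen Suppresses (D.torso t) M ∧
    M.Terminal ∧ Fintype.card M.G.V = n}

/-- The width of a tree-cut decomposition: the maximum over all adhesion sizes
and all numbers of vertices of 3-centers. -/
def width (D : TreeCutDecomp G) : ℕ :=
  max D.maxAdh (Finset.univ.sup fun t => sSup (D.threeCenterSizes t))

/-- The component `T_{tp}` of `T - p` is connected with a neat adhesion to `p`:
the adhesion of `tp` is thin and all of its edges have an endpoint in `X_p`. -/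
def NeatAdhesionTo (D : TreeCutDecomp G) (p t : D.N) : Prop :=
  (D.adh t p).ncard ≤ 2 ∧ ∀ e ∈ D.adh t p, ∃ v ∈ D.bag p, v ∈ G.ends e

end TreeCutDecomp

/-- Tree-cut width (via the width with 3-centers). -/
def tcw (G : Multigraph) : ℕ := sInf {k | ∃ D : TreeCutDecomp G, D.width = k}

/-- Tree-cut width via `width'`. -/
def tcw' (G : Multigraph) : ℕ := sInf {k | ∃ D : TreeCutDecomp G, D.width' = k}

/-- A rooted tree-cut decomposition: every tree of the forest gets a root,
encoded by a parent function (roots are their own parents) together with a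
depth function certifying well-foundedness; the parent relation orients all
tree edges. -/
structure RootedTreeCutDecomp (G : Multigraph) extends TreeCutDecomp G where
  parent : N → N
  depth : N → ℕ
  parent_adj : ∀ t : N, parent t ≠ t → T.Adj t (parent t)
  depth_lt : ∀ t : N, parent t ≠ t → depth (parent t) < depth t
  parent_cover : ∀ t t' : N, T.Adj t t' → parent t = t' ∨ parent t' = t

namespace RootedTreeCutDecomp

variable {G : Multigraph}

/-- A rooted tree-cut decomposition is neat: it is connected, and for every
non-root node `t` whose adhesion to its parent is thin and every sibling `t'`
of `t`, there are no edges of `G` between `X_{T_{tπ(t)}}` and `X_{T_{t'π(t)}}`. -/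
def Neat (D : RootedTreeCutDecomp G) : Prop :=
  D.toTreeCutDecomp.IsConnectedDecomp ∧
  ∀ t : D.N, D.parent t ≠ t →
    (D.toTreeCutDecomp.adh t (D.parent t)).ncard ≤ 2 →
    ∀ t' : D.N, t' ≠ t → D.parent t' = D.parent t → D.parent t' ≠ t' →
      ∀ e : G.E, ¬ ∃ u v : G.V, G.ends e = s(u, v) ∧
        u ∈ D.toTreeCutDecomp.side t (D.parent t) ∧
        v ∈ D.toTreeCutDecomp.side t' (D.parent t')

end RootedTreeCutDecomp

/-- An `r`-protrusion: a set of vertices with boundary of size at most `r`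
inducing an `F`-immersion-free subgraph. -/
def IsProtrusion {ι : Type} (F : ι → Multigraph) (G : Multigraph) (r : ℕ) (X : Set G.V) : Prop :=
  (G.edgeBoundary X).ncard ≤ r ∧ FFreeOn F G X

/-- `B` is an excessive protrusion inside the connected component of `G`
containing it (with parameters `b = b_F` and `c = c_F`): it is a
`2b`-protrusion with more than `2bc` induced edges, whose removal from its
component leaves at most two connected components. -/
def IsExcessiveIn {ι : Type} (F : ι → Multigraph) (b c : ℕ) (G : Multigraph)
    (B : Set G.V) : Prop :=
  ∃ v₀ ∈ B, B ⊆ G.component v₀ ∧ IsProtrusion F G (2 * b) B ∧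
    2 * b * c < (G.inducedEdges B).ncard ∧ G.compCount (G.component v₀ \ B) ≤ 2

/-- Some connected component of `G` has an excessive protrusion. -/
def HasExcessive {ι : Type} (F : ι → Multigraph) (b c : ℕ) (G : Multigraph) : Prop :=
  ∃ B : Set G.V, IsExcessiveIn F b c G B

/-- `c` is a valid constant for the protrusion-replacement lemma with width
constant `b`. -/
def ReplacerConst {ι : Type} (F : ι → Multigraph) (b c : ℕ) : Prop :=
  ∀ (G : Multigraph) (X : Set G.V), IsProtrusion F G (2 * b) X →
    c < (G.inducedEdges X).ncard →
    ∃ G' : Multigraph, OPT F G' = OPT F G ∧ G'.numEdges < G.numEdges ∧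
      ∀ D' : Finset G'.E, FFree F (G'.deleteEdges D') →
        ∃ D : Finset G.E, FFree F (G.deleteEdges D) ∧ D.card ≤ D'.card

/-- `G[U ∪ A]` and `G[U ∪ B]` are isomorphic via an isomorphism mapping every
vertex of `U` to itself. -/
def InducedIsoFixing (G : Multigraph) (U A B : Set G.V) : Prop :=
  ∃ φ : G.V → G.V, Set.BijOn φ (U ∪ A) (U ∪ B) ∧ (∀ u ∈ U, φ u = u) ∧
    ∃ ψ : G.E → G.E, Set.BijOn ψ (G.inducedEdges (U ∪ A)) (G.inducedEdges (U ∪ B)) ∧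
      ∀ e ∈ G.inducedEdges (U ∪ A), G.ends (ψ e) = (G.ends e).map φ

/-- A family of pairwise disjoint, connected `2`-protrusions all attached to
`U` and pairwise isomorphic over `U`. -/
def IsBouquetFamily {ι : Type} (F : ι → Multigraph) (G : Multigraph) (U : Set G.V)
    (𝒮 : Set (Set G.V)) : Prop :=
  (∀ S ∈ 𝒮, S.Nonempty ∧ IsProtrusion F G 2 S ∧ G.nbhd S = U ∧ G.ConnectedOn S) ∧
  𝒮.Pairwise (fun S S' => Disjoint S S') ∧
  ∀ S ∈ 𝒮, ∀ S' ∈ 𝒮, InducedIsoFixing G U S S'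

/-- A bouquet attached to `U` (with threshold `d = d_F`): an inclusion-maximal
bouquet family with at least `d` elements. -/
def IsBouquet {ι : Type} (F : ι → Multigraph) (d : ℕ) (G : Multigraph) (U : Set G.V)
    (𝒮 : Set (Set G.V)) : Prop :=
  IsBouquetFamily F G U 𝒮 ∧ d ≤ 𝒮.ncard ∧
  ∀ 𝒮' : Set (Set G.V), 𝒮 ⊆ 𝒮' → IsBouquetFamily F G U 𝒮' → 𝒮' = 𝒮

/-- The edge set of a bouquet: all edges incident to some element of it. -/
def Multigraph.bouquetEdges (G : Multigraph) (𝒮 : Set (Set G.V)) : Set G.E :=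
  {e | ∃ S ∈ 𝒮, ∃ v ∈ G.ends e, v ∈ S}

/-- A theta attached to `{u, v}` (with threshold `d = d_F`): `u` and `v` are
joined by at least `d` parallel edges (the theta itself being the maximal set
of all parallel edges between them). -/
def IsTheta (d : ℕ) (G : Multigraph) (u v : G.V) : Prop :=
  u ≠ v ∧ d ≤ (G.parallelEdges u v).ncard

/-- The constant `d_F = max(2 b_F c_F + 2 b_F, 3 MAX_F) + 1`. -/
def dConst {ι : Type} [Fintype ι] (F : ι → Multigraph) (b c : ℕ) : ℕ :=
  max (2 * b * c + 2 * b) (3 * maxEdges F) + 1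

/-- An `r`-boundaried graph. -/
structure BGraph (r : ℕ) : Type 1 where
  G : Multigraph
  bnd : Fin r → G.V

/-- Gluing two `r`-boundaried graphs: take the disjoint union and add one edge
joining the `i`-th boundary vertices, for each `i`. -/
def glue {r : ℕ} (A B : BGraph r) : Multigraph where
  V := A.G.V ⊕ B.G.V
  E := (A.G.E ⊕ B.G.E) ⊕ Fin r
  fintypeV := Fintype.ofFinite _
  fintypeE := Fintype.ofFinite _
  ends := Sum.elim
    (Sum.elim (fun e => (A.G.ends e).map Sum.inl) (fun e => (B.G.ends e).map Sum.inr))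
    (fun i => s(Sum.inl (A.bnd i), Sum.inr (B.bnd i)))
  loopless := by
    rintro ((e | e) | i) h
    · exact sym2_map_not_isDiag Sum.inl_injective (A.G.loopless e) h
    · exact sym2_map_not_isDiag Sum.inr_injective (B.G.loopless e) h
    · simp only [Sum.elim_inr, Sym2.mk_isDiag_iff] at h
      exact Sum.inl_ne_inr h

/-- The extended graph `Ĝ` of an `r`-boundaried graph: add a new pendant vertex
`û_i` adjacent exactly to the `i`-th boundary vertex, for each `i`. -/
def BGraph.extend {r : ℕ} (A : BGraph r) : Multigraph where
  V := A.G.V ⊕ Fin r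
  E := A.G.E ⊕ Fin r
  fintypeV := Fintype.ofFinite _
  fintypeE := Fintype.ofFinite _
  ends := Sum.elim (fun e => (A.G.ends e).map Sum.inl)
    (fun i => s(Sum.inl (A.bnd i), Sum.inr i))
  loopless := by
    rintro (e | i) h
    · exact sym2_map_not_isDiag Sum.inl_injective (A.G.loopless e) h
    · simp only [Sum.elim_inr, Sym2.mk_isDiag_iff] at h
      exact Sum.inl_ne_inr h

/-- A relevant pair `(Q, φ)`: a graph with at most `(r+1)·MAX_F` edges and no
isolated vertices together with a nonempty partial map from its vertices to `[r]`. -/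
def RelevantPair (r m : ℕ) (Q : Multigraph) (φ : Q.V → Option (Fin r)) : Prop :=
  Q.numEdges ≤ (r + 1) * m ∧ (∀ v : Q.V, ∃ e : Q.E, v ∈ Q.ends e) ∧ ∃ v i, φ v = some i

/-- `Ĝ - D` admits a `φ`-rooted immersion model of `Q`: an immersion model of
`Q` mapping every vertex in the domain of `φ` to the corresponding copy `û_i`. -/
def HasRootedModel {r : ℕ} (A : BGraph r) (D : Finset A.extend.E)
    (Q : Multigraph) (φ : Q.V → Option (Fin r)) : Prop :=
  ∃ M : Immersion Q (A.extend.deleteEdges D),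
    ∀ (v : Q.V) (i : Fin r), φ v = some i → M.vmap v = Sum.inr i

/-- The deletion number of an `r`-boundaried graph with respect to a set `S` of
relevant pairs: the minimum number of edges of `Ĝ` whose deletion leaves no
`φ`-rooted immersion model of `Q`, for every `(Q, φ) ∈ S`. -/
def delNum {r : ℕ} (A : BGraph r)
    (S : ∀ Q : Multigraph, (Q.V → Option (Fin r)) → Prop) : ℕ :=
  sInf {k | ∃ D : Finset A.extend.E, D.card = k ∧
    ∀ (Q : Multigraph) (φ : Q.V → Option (Fin r)), S Q φ → ¬ HasRootedModel A D Q φ}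

/-- Two `r`-boundaried graphs have the same signature: their deletion numbers
agree on every set of relevant pairs. -/
def SameSig {r : ℕ} (m : ℕ) (A B : BGraph r) : Prop :=
  ∀ S : ∀ Q : Multigraph, (Q.V → Option (Fin r)) → Prop,
    (∀ Q φ, S Q φ → RelevantPair r m Q φ) → delNum A S = delNum B S

/-- `F`-equivalence of `r`-boundaried graphs. -/
def FEquiv {ι : Type} (F : ι → Multigraph) {r : ℕ} (A B : BGraph r) : Prop :=
  ∀ C : BGraph r, OPT F (glue A C) = OPT F (glue B C)

namespace SimpleGraph

variable {N : Type} {T : SimpleGraph N} {t : N} {Y : Set N}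

/-- Split the vertex `t` of `T` into two adjacent vertices `some t` and `none`, where `none`
takes over the edges from `t` to `Y`. -/
def split (T : SimpleGraph N) (t : N) (Y : Set N) : SimpleGraph (Option N) where
  Adj
    | some a, some b => T.Adj a b ∧ ¬ (a = t ∧ b ∈ Y) ∧ ¬ (b = t ∧ a ∈ Y)
    | none, some b => b = t ∨ (T.Adj t b ∧ b ∈ Y)
    | some a, none => a = t ∨ (T.Adj t a ∧ a ∈ Y)
    | none, none => False
  symm := ⟨by rintro (_ | a) (_ | b) <;> grind [T.adj_comm]⟩
  loopless := ⟨by rintro (_ | a) <;> simp⟩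

@[simp] lemma split_some_some {a b : N} : (T.split t Y).Adj (some a) (some b) ↔
    T.Adj a b ∧ ¬ (a = t ∧ b ∈ Y) ∧ ¬ (b = t ∧ a ∈ Y) := Iff.rfl

@[simp] lemma split_none_some {b : N} : (T.split t Y).Adj none (some b) ↔
    b = t ∨ (T.Adj t b ∧ b ∈ Y) := Iff.rfl

@[simp] lemma split_some_none {a : N} : (T.split t Y).Adj (some a) none ↔
    a = t ∨ (T.Adj t a ∧ a ∈ Y) := Iff.rfl

lemma reachable_of_forall_adj {V W : Type} {G : SimpleGraph V} {H : SimpleGraph W} (f : V → W)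
    (h : ∀ a b, G.Adj a b → H.Reachable (f a) (f b)) {u v : V} (huv : G.Reachable u v) :
    H.Reachable (f u) (f v) := by
  rw [reachable_iff_reflTransGen] at huv
  induction huv with
  | refl => rfl
  | tail _ hbc ih => exact ih.trans (h _ _ hbc)

lemma mem_of_reachable {V : Type} {G : SimpleGraph V} {A : Set V}
    (h : ∀ a b, G.Adj a b → a ∈ A → b ∈ A) {u v : V} (huv : G.Reachable u v) (hu : u ∈ A) :
    v ∈ A := by
  rw [reachable_iff_reflTransGen] at huv
  induction huv with
  | refl => exact hu
  | tail _ hbc ih => exact h _ _ hbc ih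

lemma split_reachable_iff {u v : Option N} :
    (T.split t Y).Reachable u v ↔ T.Reachable (u.getD t) (v.getD t) := by
  constructor
  · intro h
    refine reachable_of_forall_adj (G := T.split t Y) (fun o => o.getD t) ?_ h
    rintro (_ | a) (_ | b) h
    · rfl
    · rcases h with rfl | h
      · rfl
      · exact h.1.reachable
    · rcases h with rfl | h
      · rfl
      · exact h.1.symm.reachable
    · exact h.1.reachable
  · intro h
    have key : ∀ u : Option N, (T.split t Y).Reachable u (some (u.getD t)) := by
      rintro (_ | a)
      · exact Adj.reachable (Or.inl rfl)
      · rfl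
    refine (key u).trans (Reachable.trans ?_ (key v).symm)
    refine reachable_of_forall_adj some (fun a b hab => ?_) h
    by_cases h1 : a = t ∧ b ∈ Y
    · obtain ⟨rfl, hb⟩ := h1
      exact (key none).symm.trans (Adj.reachable (Or.inr ⟨hab, hb⟩))
    · by_cases h2 : b = t ∧ a ∈ Y
      · obtain ⟨rfl, ha⟩ := h2
        exact (Adj.reachable (Or.inr ⟨hab.symm, ha⟩) : (T.split b Y).Reachable (some a) none).trans
          (key none)
      · exact Adj.reachable ⟨hab, h1, h2⟩

lemma split_deleteEdges {u v : Option N} (huv : (T.split t Y).Adj u v)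
    (hne : s(u, v) ≠ s(some t, none)) :
    (T.split t Y).deleteEdges {s(u, v)} =
      (T.deleteEdges {s(u.getD t, v.getD t)}).split t Y := by
  ext a b
  rcases u with _ | u <;> rcases v with _ | v <;> rcases a with _ | a <;> rcases b with _ | b <;>
    simp_all [deleteEdges_adj] <;> grind [T.adj_comm]

lemma split_adj_getD {u v : Option N} (huv : (T.split t Y).Adj u v)
    (hne : s(u, v) ≠ s(some t, none)) : T.Adj (u.getD t) (v.getD t) := by
  rcases u with _ | u <;> rcases v with _ | v <;> simp_all [T.adj_comm]

lemma IsAcyclic.not_reachable_deleteEdges (hT : T.IsAcyclic) {a b : N} (h : T.Adj a b) :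
    ¬ (T.deleteEdges {s(a, b)}).Reachable a b :=
  isBridge_iff.1 (isAcyclic_iff_forall_adj_isBridge.1 hT h)

/-- The side of `none` after removing the edge between the two parts of `t`. -/
lemma split_deleteEdges_reachable_none_iff (hT : T.IsAcyclic) (hY : ∀ y ∈ Y, T.Adj t y)
    {v : N} : ((T.split t Y).deleteEdges {s(some t, none)}).Reachable (some v) none ↔
      ∃ y ∈ Y, (T.deleteEdges {s(y, t)}).Reachable v y := by
  have hbr : ∀ y ∈ Y, ¬ (T.deleteEdges {s(y, t)}).Reachable t y := fun y hy h =>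
    hT.not_reachable_deleteEdges (hY y hy).symm h.symm
  constructor
  · intro h
    let A : Set (Option N) := {o | ∀ v, o = some v →
      ∃ y ∈ Y, (T.deleteEdges {s(y, t)}).Reachable v y}
    refine mem_of_reachable (A := A) ?_ h.symm (by simp [A]) v rfl
    rintro (_ | a) (_ | b) hab hA w hw
    · exact absurd hab (by simp)
    · obtain rfl := Option.some_inj.1 hw
      rw [deleteEdges_adj] at hab
      obtain ⟨rfl | ⟨_, hb⟩, h2⟩ := hab
      · exact absurd (Sym2.eq_swap) h2
      · exact ⟨b, hb, by rfl⟩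
    · simp at hw
    · obtain rfl := Option.some_inj.1 hw
      obtain ⟨y, hy, hay⟩ := hA a rfl
      refine ⟨y, hy, Reachable.trans (Adj.reachable ?_) hay⟩
      rw [deleteEdges_adj] at hab ⊢
      refine ⟨hab.1.1.symm, fun hh => ?_⟩
      rw [Set.mem_singleton_iff, Sym2.eq_iff] at hh
      rcases hh with ⟨rfl, rfl⟩ | ⟨rfl, rfl⟩
      · exact hbr _ hy hay
      · exact hab.1.2.2 ⟨rfl, hy⟩
  · rintro ⟨y, hy, h⟩
    let A : Set N := {a | (T.deleteEdges {s(y, t)}).Reachable a y ∧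
      ((T.split t Y).deleteEdges {s(some t, none)}).Reachable (some a) none}
    have hyA : y ∈ A := by
      refine ⟨by rfl, Adj.reachable ?_⟩
      rw [deleteEdges_adj]
      refine ⟨Or.inr ⟨hY y hy, hy⟩, ?_⟩
      have := (hY y hy).ne
      simp [this.symm]
    refine (mem_of_reachable (A := A) ?_ h.symm hyA).2
    rintro a b hab ⟨h1, h2⟩
    have hb : (T.deleteEdges {s(y, t)}).Reachable b y := (hab.symm.reachable).trans h1
    refine ⟨hb, Reachable.trans (Adj.reachable ?_) h2⟩
    rw [deleteEdges_adj] at hab ⊢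
    refine ⟨⟨hab.1.symm, ?_, ?_⟩, by simp⟩
    · rintro ⟨rfl, _⟩; exact hbr _ hy hb
    · rintro ⟨rfl, _⟩; exact hbr _ hy h1

lemma IsAcyclic.split (hT : T.IsAcyclic) (hY : ∀ y ∈ Y, T.Adj t y) : (T.split t Y).IsAcyclic := by
  rw [isAcyclic_iff_forall_adj_isBridge]
  intro u v huv
  by_cases hne : s(u, v) = s(some t, none)
  · rw [hne, isBridge_iff, split_deleteEdges_reachable_none_iff hT hY]
    rintro ⟨y, hy, h⟩
    exact hT.not_reachable_deleteEdges (hY y hy).symm h.symm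
  · rw [isBridge_iff, split_deleteEdges huv hne, split_reachable_iff]
    exact hT.not_reachable_deleteEdges (split_adj_getD huv hne)

end SimpleGraph
namespace Multigraph

variable {G : Multigraph}

/-- The number of edges leaving `S`. -/
def cutSize (G : Multigraph) (S : Set G.V) : ℕ := (G.edgeBoundary S).ncard

lemma mem_edgeBoundary_iff {S : Set G.V} {e : G.E} {u v : G.V} (h : G.ends e = s(u, v)) :
    e ∈ G.edgeBoundary S ↔ (u ∈ S ∧ v ∉ S) ∨ (v ∈ S ∧ u ∉ S) := by
  constructor
  · rintro ⟨a, b, hab, ha, hb⟩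
    rw [h, Sym2.eq_iff] at hab
    rcases hab with ⟨rfl, rfl⟩ | ⟨rfl, rfl⟩
    · exact Or.inl ⟨ha, hb⟩
    · exact Or.inr ⟨ha, hb⟩
  · rintro (⟨h1, h2⟩ | ⟨h1, h2⟩)
    · exact ⟨u, v, h, h1, h2⟩
    · exact ⟨v, u, h.trans Sym2.eq_swap, h1, h2⟩

lemma cutSize_add_le_of_subset {A B C D : Set G.V}
    (h1 : G.edgeBoundary C ∪ G.edgeBoundary D ⊆ G.edgeBoundary A ∪ G.edgeBoundary B)
    (h2 : G.edgeBoundary C ∩ G.edgeBoundary D ⊆ G.edgeBoundary A ∩ G.edgeBoundary B) :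
    G.cutSize C + G.cutSize D ≤ G.cutSize A + G.cutSize B := by
  unfold cutSize
  rw [← Set.ncard_union_add_ncard_inter (G.edgeBoundary C),
    ← Set.ncard_union_add_ncard_inter (G.edgeBoundary A)]
  exact add_le_add (Set.ncard_le_ncard h1) (Set.ncard_le_ncard h2)

lemma cutSize_inter_add_cutSize_union_le (A B : Set G.V) :
    G.cutSize (A ∩ B) + G.cutSize (A ∪ B) ≤ G.cutSize A + G.cutSize B := by
  apply cutSize_add_le_of_subset <;> intro e <;>
    obtain ⟨⟨u, v⟩, he⟩ := Sym2.mk_surjective (G.ends e)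
  all_goals
    simp only [Set.mem_union, Set.mem_inter_iff, mem_edgeBoundary_iff he.symm]
    tauto

lemma cutSize_diff_add_cutSize_diff_le (A B : Set G.V) :
    G.cutSize (A \ B) + G.cutSize (B \ A) ≤ G.cutSize A + G.cutSize B := by
  apply cutSize_add_le_of_subset <;> intro e <;>
    obtain ⟨⟨u, v⟩, he⟩ := Sym2.mk_surjective (G.ends e)
  all_goals
    simp only [Set.mem_union, Set.mem_inter_iff, Set.mem_sdiff, mem_edgeBoundary_iff he.symm]
    tauto

lemma cutSize_empty : G.cutSize ∅ = 0 := by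
  simp [cutSize, edgeBoundary]

/-- The members of `ℛ` can be ordered such that each of them is separated by at most two edges
after merging it with some of its predecessors. -/
def Eliminable (G : Multigraph) (ℛ : Set (Set G.V)) : Prop :=
  ∀ Q ⊂ ℛ, ∃ z ∈ ℛ, z ∉ Q ∧ ∃ 𝒴 ⊆ insert z Q, z ∈ 𝒴 ∧ G.cutSize (⋃₀ 𝒴) ≤ 2

lemma sUnion_diff_of_pairwiseDisjoint {α : Type} {𝒞 𝒜 ℬ : Set (Set α)}
    (h𝒞 : 𝒞.PairwiseDisjoint id) (h𝒜 : 𝒜 ⊆ 𝒞) (hℬ : ℬ ⊆ 𝒞) :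
    ⋃₀ (𝒜 \ ℬ) = ⋃₀ 𝒜 \ ⋃₀ ℬ := by
  ext v
  simp only [Set.mem_sUnion, Set.mem_sdiff]
  constructor
  · rintro ⟨s, ⟨hs, hs'⟩, hv⟩
    refine ⟨⟨s, hs, hv⟩, ?_⟩
    rintro ⟨s', h', hv'⟩
    exact hs' (h𝒞.elim_set (h𝒜 hs) (hℬ h') v hv hv' ▸ h')
  · rintro ⟨⟨s, hs, hv⟩, h⟩
    exact ⟨s, ⟨hs, fun h' => h ⟨s, h', hv⟩⟩, hv⟩

lemma sUnion_inter_of_pairwiseDisjoint {α : Type} {𝒞 𝒜 ℬ : Set (Set α)}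
    (h𝒞 : 𝒞.PairwiseDisjoint id) (h𝒜 : 𝒜 ⊆ 𝒞) (hℬ : ℬ ⊆ 𝒞) :
    ⋃₀ (𝒜 ∩ ℬ) = ⋃₀ 𝒜 ∩ ⋃₀ ℬ := by
  ext v
  simp only [Set.mem_sUnion, Set.mem_inter_iff]
  constructor
  · rintro ⟨s, ⟨hs, hs'⟩, hv⟩
    exact ⟨⟨s, hs, hv⟩, s, hs', hv⟩
  · rintro ⟨⟨s, hs, hv⟩, s', hs', hv'⟩
    exact ⟨s, ⟨hs, h𝒞.elim_set (h𝒜 hs) (hℬ hs') v hv hv' ▸ hs'⟩, hv⟩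

/-- If an eliminable family has a member with a bold boundary, then one such member can be merged
with members with thin boundaries into a set with a thin boundary, in such a way that the family
stays eliminable. -/
lemma Eliminable.exists_merge {𝒞 ℛ : Set (Set G.V)} (h𝒞 : 𝒞.PairwiseDisjoint id)
    (hℛ𝒞 : ℛ ⊆ 𝒞) (hℛ : G.Eliminable ℛ) (hbold : ∃ b ∈ ℛ, 2 < G.cutSize b) :
    ∃ b, 2 < G.cutSize b ∧ ∃ 𝒴 ⊆ ℛ, b ∈ 𝒴 ∧ (∀ y ∈ 𝒴, y ≠ b → G.cutSize y ≤ 2) ∧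
      G.cutSize (⋃₀ 𝒴) ≤ 2 ∧ G.Eliminable (insert (⋃₀ 𝒴) (ℛ \ 𝒴)) := by
  obtain ⟨b, hbℛ, hb, 𝒴₀, h𝒴₀, hb𝒴₀, hcut₀⟩ := hℛ {r ∈ ℛ | G.cutSize r ≤ 2} (by
    refine Set.ssubset_iff_subset_ne.2 ⟨Set.sep_subset _ _, fun h => ?_⟩
    obtain ⟨b, hb, h2⟩ := hbold
    rw [← h] at hb
    exact absurd hb.2 (by omega))
  have hb2 : 2 < G.cutSize b := by
    by_contra h
    exact hb ⟨hbℛ, by omega⟩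
  obtain ⟨𝒴, h𝒴le, h𝒴min⟩ := Set.Finite.exists_le_minimal
    (Set.toFinite {𝒴 : Set (Set G.V) | 𝒴 ⊆ insert b {r ∈ ℛ | G.cutSize r ≤ 2} ∧ b ∈ 𝒴 ∧
      G.cutSize (⋃₀ 𝒴) ≤ 2}) (a := 𝒴₀) ⟨h𝒴₀, hb𝒴₀, hcut₀⟩
  obtain ⟨h𝒴sub, hb𝒴, hcut⟩ := h𝒴min.prop
  have h𝒴ℛ : 𝒴 ⊆ ℛ := fun y hy => by
    rcases h𝒴sub hy with rfl | h
    · exact hbℛ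
    · exact h.1
  have hmin : ∀ 𝒵 ⊆ 𝒴, b ∈ 𝒵 → 𝒵 ≠ 𝒴 → 2 < G.cutSize (⋃₀ 𝒵) := by
    intro 𝒵 h𝒵 hb𝒵 hne
    by_contra h
    exact hne (h𝒵.antisymm (h𝒴min.le_of_le ⟨h𝒵.trans h𝒴sub, hb𝒵, by omega⟩ h𝒵))
  refine ⟨b, hb2, 𝒴, h𝒴ℛ, hb𝒴, ?_, hcut, ?_⟩
  · intro y hy hne
    rcases h𝒴sub hy with rfl | h
    · exact absurd rfl hne
    · exact h.2
  intro Q hQ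
  by_cases hU : ⋃₀ 𝒴 ∈ Q
  swap
  · exact ⟨⋃₀ 𝒴, Set.mem_insert _ _, hU, {⋃₀ 𝒴}, by simp, rfl, by simpa using hcut⟩
  have hQ' : (Q ∩ (ℛ \ 𝒴)) ∪ 𝒴 ⊂ ℛ := by
    refine Set.ssubset_iff_subset_ne.2 ⟨?_, fun h => hQ.2 ?_⟩
    · rintro r (⟨_, hr⟩ | hr)
      · exact hr.1
      · exact h𝒴ℛ hr
    · rintro r (rfl | ⟨hr, hr'⟩)
      · exact hU
      · rw [← h] at hr
        rcases hr with hr | hr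
        · exact hr.1
        · exact absurd hr hr'
  obtain ⟨z, hzℛ, hzQ, 𝒵, h𝒵, hz𝒵, hcut𝒵⟩ := hℛ _ hQ'
  have hz𝒴 : z ∉ 𝒴 := fun h => hzQ (Or.inr h)
  have hzQ' : z ∉ Q := fun h => hzQ (Or.inl ⟨h, hzℛ, hz𝒴⟩)
  have h𝒵ℛ : 𝒵 ⊆ ℛ := fun y hy => by
    rcases h𝒵 hy with rfl | h
    · exact hzℛ
    · exact hQ'.1 h
  have h𝒵𝒴 : 𝒵 \ 𝒴 ⊆ insert z Q := by
    rintro y ⟨hy, hy'⟩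
    rcases h𝒵 hy with rfl | h | h
    · exact Set.mem_insert _ _
    · exact Or.inr h.1
    · exact absurd h hy'
  refine ⟨z, Or.inr ⟨hzℛ, hz𝒴⟩, hzQ', ?_⟩
  have hmerge : G.cutSize (⋃₀ 𝒵 ∪ ⋃₀ 𝒴) ≤ 2 →
      ∃ 𝒲 ⊆ insert z Q, z ∈ 𝒲 ∧ G.cutSize (⋃₀ 𝒲) ≤ 2 := by
    intro h
    refine ⟨insert (⋃₀ 𝒴) (𝒵 \ 𝒴), ?_, Or.inr ⟨hz𝒵, hz𝒴⟩, ?_⟩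
    · rintro y (rfl | hy)
      · exact Or.inr hU
      · exact h𝒵𝒴 hy
    · rw [Set.sUnion_insert, sUnion_diff_of_pairwiseDisjoint h𝒞 (h𝒵ℛ.trans hℛ𝒞) (h𝒴ℛ.trans hℛ𝒞),
        Set.union_sdiff_self, Set.union_comm]
      exact h
  by_cases hb𝒵 : b ∈ 𝒵
  · by_cases hsub : 𝒵 ∩ 𝒴 = 𝒴
    · refine hmerge ?_
      rw [Set.union_eq_self_of_subset_right (Set.sUnion_mono (Set.inter_eq_right.1 hsub))]
      exact hcut𝒵
    · have h1 := hmin (𝒵 ∩ 𝒴) Set.inter_subset_right ⟨hb𝒵, hb𝒴⟩ hsub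
      rw [sUnion_inter_of_pairwiseDisjoint h𝒞 (h𝒵ℛ.trans hℛ𝒞) (h𝒴ℛ.trans hℛ𝒞)] at h1
      have h2 := cutSize_inter_add_cutSize_union_le (G := G) (⋃₀ 𝒵) (⋃₀ 𝒴)
      exact hmerge (by omega)
  · refine ⟨𝒵 \ 𝒴, h𝒵𝒴, ⟨hz𝒵, hz𝒴⟩, ?_⟩
    by_cases hdis : 𝒴 \ 𝒵 = 𝒴
    · rw [sdiff_eq_left.2 (sdiff_eq_left.1 hdis).symm]
      exact hcut𝒵
    · have h1 := hmin (𝒴 \ 𝒵) Set.sdiff_subset ⟨hb𝒴, hb𝒵⟩ hdis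
      rw [sUnion_diff_of_pairwiseDisjoint h𝒞 (h𝒴ℛ.trans hℛ𝒞) (h𝒵ℛ.trans hℛ𝒞)] at h1
      rw [sUnion_diff_of_pairwiseDisjoint h𝒞 (h𝒵ℛ.trans hℛ𝒞) (h𝒴ℛ.trans hℛ𝒞)]
      have h2 := cutSize_diff_add_cutSize_diff_le (G := G) (⋃₀ 𝒵) (⋃₀ 𝒴)
      omega

end Multigraph
namespace SimpleGraph

variable {N : Type} {T : SimpleGraph N} {t : N}

lemma IsAcyclic.reachable_deleteEdges_iff (hT : T.IsAcyclic) {x u : N} (h : T.Adj t x) :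
    (T.deleteEdges {s(x, t)}).Reachable u x ↔
      (T.deleteEdges {e : Sym2 N | t ∈ e}).Reachable u x := by
  constructor
  · intro hu
    let A : Set N := {a | (T.deleteEdges {s(x, t)}).Reachable a x ∧
      (T.deleteEdges {e : Sym2 N | t ∈ e}).Reachable a x}
    refine (mem_of_reachable (A := A) ?_ hu.symm ⟨by rfl, by rfl⟩).2
    rintro a b hab ⟨ha, ha'⟩
    have hb := hab.symm.reachable.trans ha
    refine ⟨hb, Reachable.trans (Adj.reachable ?_) ha'⟩
    rw [deleteEdges_adj] at hab ⊢
    refine ⟨hab.1.symm, fun hmem => ?_⟩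
    rw [Set.mem_ofPred_eq, Sym2.mem_iff] at hmem
    have hbr := hT.not_reachable_deleteEdges h.symm
    rcases hmem with rfl | rfl
    · exact hbr hb.symm
    · exact hbr ha.symm
  · refine fun hu => hu.mono (deleteEdges_anti ?_)
    rintro e rfl
    exact Sym2.mem_mk_right _ _

lemma reachable_iff_eq_or_exists_adj {u : N} (h : T.Reachable u t) :
    u = t ∨ ∃ x, T.Adj t x ∧ (T.deleteEdges {e : Sym2 N | t ∈ e}).Reachable u x := by
  refine mem_of_reachable (A := {u | u = t ∨ ∃ x, T.Adj t x ∧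
    (T.deleteEdges {e : Sym2 N | t ∈ e}).Reachable u x}) ?_ h.symm (Or.inl rfl)
  rintro a b hab (rfl | ⟨x, hx, hax⟩)
  · exact Or.inr ⟨b, hab, by rfl⟩
  · by_cases hb : b = t
    · exact Or.inl hb
    · by_cases ha : a = t
      · subst ha
        exact Or.inr ⟨b, hab, by rfl⟩
      · refine Or.inr ⟨x, hx, Reachable.trans (Adj.reachable ?_) hax⟩
        rw [deleteEdges_adj]
        exact ⟨hab.symm, by simp [Ne.symm ha, Ne.symm hb]⟩

end SimpleGraph

namespace TreeCutDecomp

open SimpleGraph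

variable {G : Multigraph} (D : TreeCutDecomp G)

lemma mem_bag_iff {v : G.V} {t : D.N} : v ∈ D.bag t ↔ D.nodeOf v = t := by
  constructor
  · intro h
    by_contra hne
    exact Finset.disjoint_left.1 (D.bag_disjoint _ _ hne) (D.mem_bag v) h
  · rintro rfl
    exact D.mem_bag v

lemma reachable_nodeOf {e : G.E} {u v : G.V} (he : G.ends e = s(u, v)) :
    D.T.Reachable (D.nodeOf u) (D.nodeOf v) :=
  (D.comp_compat u v).1 ⟨.cons e he (.nil v)⟩

lemma mem_side_iff {t x : D.N} (h : D.T.Adj t x) {v : G.V} : v ∈ D.side x t ↔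
    (D.T.deleteEdges {e : Sym2 D.N | t ∈ e}).Reachable (D.nodeOf v) x :=
  D.acyclic.reachable_deleteEdges_iff h

lemma reachable_of_mem_side {a b : D.N} {v : G.V} (hv : v ∈ D.side a b) :
    D.T.Reachable (D.nodeOf v) a :=
  Reachable.mono (deleteEdges_le _) hv

lemma notMem_side_swap {a b : D.N} (h : D.T.Adj a b) {v : G.V} (hv : v ∈ D.side a b) :
    v ∉ D.side b a := by
  intro hv'
  rw [side, Set.mem_ofPred_eq, Sym2.eq_swap] at hv'
  exact D.acyclic.not_reachable_deleteEdges h (Reachable.trans (Reachable.symm hv) hv')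

lemma notMem_side_of_mem_bag {t x : D.N} (h : D.T.Adj t x) {v : G.V} (hv : v ∈ D.bag t) :
    v ∉ D.side x t := by
  rw [mem_bag_iff] at hv
  refine D.notMem_side_swap h ?_
  rw [side, Set.mem_ofPred_eq, hv]

lemma mem_side_or_mem_side {a b : D.N} {v : G.V}
    (hv : D.T.Reachable (D.nodeOf v) a) : v ∈ D.side a b ∨ v ∈ D.side b a := by
  let A : Set D.N := {x | (D.T.deleteEdges {s(a, b)}).Reachable x a ∨
    (D.T.deleteEdges {s(b, a)}).Reachable x b}
  refine mem_of_reachable (A := A) ?_ hv.symm (Or.inl (by rfl))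
  intro x y hxy hx
  by_cases he : s(x, y) = s(a, b)
  · rw [Sym2.eq_iff] at he
    rcases he with ⟨rfl, rfl⟩ | ⟨rfl, rfl⟩
    · exact Or.inr (by rfl)
    · exact Or.inl (by rfl)
  · rw [Sym2.eq_swap] at he
    refine hx.imp (fun h => Reachable.trans (Adj.reachable ?_) h)
      (fun h => Reachable.trans (Adj.reachable ?_) h)
    · exact deleteEdges_adj.2 ⟨hxy.symm, he⟩
    · rw [Sym2.eq_swap (a := b)]
      exact deleteEdges_adj.2 ⟨hxy.symm, he⟩

lemma mem_bag_or_exists_mem_side {t : D.N} {v : G.V} (h : D.T.Reachable (D.nodeOf v) t) :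
    v ∈ D.bag t ∨ ∃ x, D.T.Adj t x ∧ v ∈ D.side x t := by
  rcases reachable_iff_eq_or_exists_adj h with h | ⟨x, hx, hvx⟩
  · exact Or.inl (D.mem_bag_iff.2 h)
  · exact Or.inr ⟨x, hx, (D.mem_side_iff hx).2 hvx⟩

lemma eq_of_mem_side {t x y : D.N} (hx : D.T.Adj t x) (hy : D.T.Adj t y) {v : G.V}
    (hvx : v ∈ D.side x t) (hvy : v ∈ D.side y t) : x = y := by
  by_contra hne
  have hxy : (D.T.deleteEdges {s(x, t)}).Reachable y x :=
    (D.acyclic.reachable_deleteEdges_iff hx).2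
      (((D.mem_side_iff hy).1 hvy).symm.trans ((D.mem_side_iff hx).1 hvx))
  refine D.acyclic.not_reachable_deleteEdges hx.symm
    ((Reachable.trans (Adj.reachable ?_) hxy).symm)
  rw [deleteEdges_adj]
  refine ⟨hy, fun h => ?_⟩
  rw [Set.mem_singleton_iff, Sym2.eq_iff] at h
  rcases h with ⟨h, _⟩ | ⟨_, h⟩
  · exact hx.ne h
  · exact hne h.symm

lemma adh_eq_edgeBoundary {a b : D.N} (h : D.T.Adj a b) :
    D.adh a b = G.edgeBoundary (D.side a b) := by
  ext e
  constructor
  · rintro ⟨u, v, he, hu, hv⟩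
    exact ⟨u, v, he, hu, D.notMem_side_swap h.symm hv⟩
  · rintro ⟨u, v, he, hu, hv⟩
    refine ⟨u, v, he, hu, (D.mem_side_or_mem_side ?_).resolve_left hv⟩
    exact (D.reachable_nodeOf he).symm.trans (D.reachable_of_mem_side hu)

lemma adh_comm (a b : D.N) : D.adh a b = D.adh b a := by
  ext e
  constructor <;> rintro ⟨u, v, he, hu, hv⟩ <;> exact ⟨v, u, he.trans Sym2.eq_swap, hv, hu⟩

lemma ncard_adh {t x : D.N} (h : D.T.Adj t x) : (D.adh t x).ncard = G.cutSize (D.side x t) := by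
  rw [adh_comm, adh_eq_edgeBoundary D h.symm, cutSize]

lemma maxAdh_le_iff {k : ℕ} :
    D.maxAdh ≤ k ↔ ∀ a b, D.T.Adj a b → (D.adh a b).ncard ≤ k := by
  simp only [maxAdh, Finset.sup_le_iff, Finset.mem_univ, true_imp_iff, Prod.forall]
  refine forall₂_congr fun a b => ?_
  split_ifs with h <;> simp [h]

/-- The neighbours of `t` with bold adhesion. -/
def boldNeighbors (t : D.N) : Set D.N := {x | D.T.Adj t x ∧ 2 < (D.adh t x).ncard}

lemma wval_eq (t : D.N) : D.wval t = (D.bag t).card + (D.boldNeighbors t).ncard := rfl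

/-- The vertex sets of the components of `T - t`, for the tree `T` containing `t`. -/
def neighborSides (t : D.N) : Set (Set G.V) := (fun x => D.side x t) '' {x | D.T.Adj t x}

lemma pairwiseDisjoint_neighborSides (t : D.N) : (D.neighborSides t).PairwiseDisjoint id := by
  rintro _ ⟨x, hx, rfl⟩ _ ⟨y, hy, rfl⟩ hne
  refine Set.disjoint_left.2 fun v hv hv' => hne ?_
  rw [D.eq_of_mem_side hx hy hv hv']

lemma nonempty_of_cutSize {S : Set G.V} (h : 2 < G.cutSize S) : S.Nonempty := by
  rw [Set.nonempty_iff_ne_empty]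
  rintro rfl
  simp [cutSize_empty] at h

lemma eq_of_side_eq {t x y : D.N} (hx : D.T.Adj t x) (hy : D.T.Adj t y)
    (h : 2 < G.cutSize (D.side x t)) (hxy : D.side x t = D.side y t) : x = y := by
  obtain ⟨v, hv⟩ := nonempty_of_cutSize h
  exact D.eq_of_mem_side hx hy hv (hxy ▸ hv)

lemma mem_boldNeighbors_iff {t x : D.N} :
    x ∈ D.boldNeighbors t ↔ D.T.Adj t x ∧ 2 < G.cutSize (D.side x t) :=
  and_congr_right fun h => by rw [D.ncard_adh h]

/-- The decomposition obtained by splitting the node `t` into two adjacent nodes `some t`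
and `none`, the former keeping the bag and the latter taking over the neighbours in `Y`. -/
abbrev splitNode (t : D.N) (Y : Set D.N) (hY : ∀ y ∈ Y, D.T.Adj t y) : TreeCutDecomp G where
  N := Option D.N
  fintypeN := inferInstance
  T := D.T.split t Y
  acyclic := D.acyclic.split hY
  bag o := o.elim ∅ D.bag
  nodeOf v := some (D.nodeOf v)
  mem_bag v := D.mem_bag v
  bag_disjoint := by
    rintro (_ | a) (_ | b) h
    · simp
    · simp
    · simp
    · exact D.bag_disjoint a b (fun h' => h (congrArg some h'))
  comp_compat u v := by
    rw [split_reachable_iff]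
    exact D.comp_compat u v
  trees_used o := by
    obtain ⟨v, hv⟩ := D.trees_used (o.getD t)
    exact ⟨v, split_reachable_iff.2 hv⟩

section splitNode

variable {D} {t : D.N} {Y : Set D.N} {hY : ∀ y ∈ Y, D.T.Adj t y}

lemma side_splitNode {u v : Option D.N} (huv : (D.T.split t Y).Adj u v)
    (hne : s(u, v) ≠ s(some t, none)) :
    (D.splitNode t Y hY).side u v = D.side (u.getD t) (v.getD t) := by
  ext x
  change ((D.T.split t Y).deleteEdges {s(u, v)}).Reachable (some (D.nodeOf x)) u ↔ _
  rw [split_deleteEdges huv hne, split_reachable_iff]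
  rfl

lemma side_splitNode_none : (D.splitNode t Y hY).side none (some t) = ⋃ y ∈ Y, D.side y t := by
  ext x
  change ((D.T.split t Y).deleteEdges {s(none, some t)}).Reachable (some (D.nodeOf x)) none ↔ _
  rw [Sym2.eq_swap, split_deleteEdges_reachable_none_iff D.acyclic hY]
  simp [side]

lemma cutSize_side_splitNode_le {k : ℕ} (hk : D.maxAdh ≤ k)
    {u v : Option D.N} (huv : (D.T.split t Y).Adj u v) (hne : s(u, v) ≠ s(some t, none)) :
    G.cutSize ((D.splitNode t Y hY).side u v) ≤ k := by
  rw [side_splitNode huv hne, ← D.ncard_adh (split_adj_getD huv hne).symm]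
  exact D.maxAdh_le_iff.1 hk _ _ (split_adj_getD huv hne).symm

lemma maxAdh_splitNode_le {k : ℕ} (hk : D.maxAdh ≤ k)
    (hcut : G.cutSize (⋃ y ∈ Y, D.side y t) ≤ k) : (D.splitNode t Y hY).maxAdh ≤ k := by
  rw [maxAdh_le_iff]
  rintro (u : Option D.N) (v : Option D.N) (huv : (D.T.split t Y).Adj u v)
  by_cases hne : s(u, v) = s(some t, none)
  · rw [Sym2.eq_iff] at hne
    rcases hne with ⟨rfl, rfl⟩ | ⟨rfl, rfl⟩
    · rw [ncard_adh _ huv, side_splitNode_none]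
      exact hcut
    · rw [adh_comm, ncard_adh _ huv.symm, side_splitNode_none]
      exact hcut
  · rw [ncard_adh _ huv]
    exact cutSize_side_splitNode_le hk huv.symm (by rwa [Sym2.eq_swap])

lemma neighborSides_splitNode_of_ne {s : D.N} (hs : s ≠ t) :
    (D.splitNode t Y hY).neighborSides (some s) = D.neighborSides s := by
  have hne : ∀ o : Option D.N, s(o, some s) ≠ s(some t, none) := by
    rintro (_ | o) <;> simp [hs]
  ext S
  constructor
  · rintro ⟨o, ho, rfl⟩
    have ho' : (D.T.split t Y).Adj o (some s) := ho.symm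
    exact ⟨o.getD t, (split_adj_getD ho' (hne o)).symm, (side_splitNode ho' (hne o)).symm⟩
  · rintro ⟨x, hx, rfl⟩
    by_cases h : x = t ∧ s ∈ Y
    · obtain ⟨rfl, h⟩ := h
      have ho : (D.T.split x Y).Adj none (some s) := Or.inr ⟨hx.symm, h⟩
      exact ⟨none, ho.symm, side_splitNode ho (hne _)⟩
    · have ho : (D.T.split t Y).Adj (some x) (some s) := ⟨hx.symm, h, by tauto⟩
      exact ⟨some x, ho.symm, side_splitNode ho (hne _)⟩

lemma wval_splitNode_of_ne {s : D.N} (hs : s ≠ t) :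
    (D.splitNode t Y hY).wval (some s) ≤ D.wval s := by
  have hne : ∀ o : Option D.N, s(o, some s) ≠ s(some t, none) := by
    rintro (_ | o) <;> simp [hs]
  refine Nat.add_le_add_left (Set.ncard_le_ncard_of_injOn
    (s := (D.splitNode t Y hY).boldNeighbors (some s)) (fun o : Option D.N => o.getD t) ?_ ?_) _
  · intro (o : Option D.N) ho
    rw [mem_boldNeighbors_iff] at ho
    have ho' : (D.T.split t Y).Adj o (some s) := ho.1.symm
    rw [side_splitNode ho' (hne o)] at ho
    exact D.mem_boldNeighbors_iff.2 ⟨(split_adj_getD ho' (hne o)).symm, ho.2⟩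
  · intro (o : Option D.N) ho (o' : Option D.N) ho' h
    rw [mem_boldNeighbors_iff] at ho ho'
    have h1 : (D.T.split t Y).Adj o (some s) := ho.1.symm
    have h2 : (D.T.split t Y).Adj o' (some s) := ho'.1.symm
    refine eq_of_side_eq _ ho.1 ho'.1 ho.2 ?_
    rw [side_splitNode h1 (hne o), side_splitNode h2 (hne o')]
    simp only [h]

end splitNode

end TreeCutDecomp
namespace TreeCutDecomp

open SimpleGraph

variable {G : Multigraph}

section splitNode

variable {D : TreeCutDecomp G} {t : D.N} {Y : Set D.N} {hY : ∀ y ∈ Y, D.T.Adj t y}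

lemma neighborSides_splitNode_self : (D.splitNode t Y hY).neighborSides (some t) =
    insert (⋃ y ∈ Y, D.side y t) ((fun x => D.side x t) '' {x | D.T.Adj t x ∧ x ∉ Y}) := by
  have key : ∀ x, D.T.Adj t x → x ∉ Y → (D.T.split t Y).Adj (some x) (some t) := fun x hx hxY =>
    ⟨hx.symm, fun h => hx.ne h.1.symm, fun h => hxY h.2⟩
  ext S
  constructor
  · rintro ⟨_ | x, ho, rfl⟩
    · exact Or.inl side_splitNode_none
    · have ho' : (D.T.split t Y).Adj (some x) (some t) := ho.symm
      refine Or.inr ⟨x, ⟨ho'.1.symm, fun hx => ho'.2.2 ⟨rfl, hx⟩⟩, ?_⟩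
      exact (side_splitNode ho' (by simp)).symm
  · rintro (rfl | ⟨x, ⟨hx, hxY⟩, rfl⟩)
    · exact ⟨none, Or.inl rfl, side_splitNode_none⟩
    · exact ⟨some x, (key x hx hxY).symm, side_splitNode (key x hx hxY) (by simp)⟩

lemma boldNeighbors_splitNode_self (hcut : G.cutSize (⋃ y ∈ Y, D.side y t) ≤ 2) :
    (D.splitNode t Y hY).boldNeighbors (some t) ⊆ some '' (D.boldNeighbors t \ Y) := by
  rintro (_ | x) hx
  · rw [mem_boldNeighbors_iff, side_splitNode_none] at hx
    omega
  · rw [mem_boldNeighbors_iff] at hx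
    have hx' : (D.T.split t Y).Adj (some x) (some t) := hx.1.symm
    rw [side_splitNode hx' (by simp)] at hx
    exact ⟨x, ⟨D.mem_boldNeighbors_iff.2 ⟨hx'.1.symm, hx.2⟩, fun h => hx'.2.2 ⟨rfl, h⟩⟩, rfl⟩

lemma boldNeighbors_splitNode_none (hcut : G.cutSize (⋃ y ∈ Y, D.side y t) ≤ 2) :
    (D.splitNode t Y hY).boldNeighbors none ⊆ some '' (D.boldNeighbors t ∩ Y) := by
  rintro (_ | x) hx
  · exact absurd hx.1 (SimpleGraph.irrefl _)
  · have hxn : (D.T.split t Y).Adj none (some x) := hx.1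
    by_cases hxt : x = t
    · subst hxt
      have h := hx.2
      rw [adh_comm, ncard_adh _ hxn.symm, side_splitNode_none] at h
      omega
    · have hxY := hxn.resolve_left hxt
      rw [mem_boldNeighbors_iff, side_splitNode hxn.symm (by simp [hxt])] at hx
      exact ⟨x, ⟨D.mem_boldNeighbors_iff.2 ⟨hxY.1, hx.2⟩, hxY.2⟩, rfl⟩

end splitNode

/-- Some eliminable family of components of `T - t` leaves, together with the bag of `t`, at
most `k` vertices of the torso at `t`. -/
def IsReducible (D : TreeCutDecomp G) (k : ℕ) (t : D.N) : Prop :=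
  ∃ ℛ ⊆ D.neighborSides t, G.Eliminable ℛ ∧
    (D.bag t).card + (D.neighborSides t \ ℛ).ncard ≤ k

/-- The total amount by which `wval` exceeds `k`. -/
def excess (D : TreeCutDecomp G) (k : ℕ) : ℕ := ∑ t : D.N, (D.wval t - k)

lemma excess_splitNode (D : TreeCutDecomp G) (k : ℕ) (t : D.N) (Y : Set D.N)
    (hY : ∀ y ∈ Y, D.T.Adj t y) :
    (D.splitNode t Y hY).excess k = ((D.splitNode t Y hY).wval none - k) +
      ∑ s : D.N, ((D.splitNode t Y hY).wval (some s) - k) :=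
  Fintype.sum_option (fun o : Option D.N => (D.splitNode t Y hY).wval o - k)

lemma exists_bold_mem {D : TreeCutDecomp G} {k : ℕ} {t : D.N} {ℛ : Set (Set G.V)}
    (hcard : (D.bag t).card + (D.neighborSides t \ ℛ).ncard ≤ k) (ht : k < D.wval t) :
    ∃ b ∈ ℛ, 2 < G.cutSize b := by
  by_contra! h
  have : (D.boldNeighbors t).ncard ≤ (D.neighborSides t \ ℛ).ncard := by
    refine Set.ncard_le_ncard_of_injOn (fun x => D.side x t) ?_ ?_
    · intro x hx
      rw [mem_boldNeighbors_iff] at hx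
      exact ⟨⟨x, hx.1, rfl⟩, fun hmem => absurd (h _ hmem) (by omega)⟩
    · intro x hx y hy hxy
      rw [mem_boldNeighbors_iff] at hx hy
      exact D.eq_of_side_eq hx.1 hy.1 hx.2 hxy
  rw [wval_eq] at ht
  omega

lemma exists_excess_lt {D : TreeCutDecomp G} {k : ℕ} (hadh : D.maxAdh ≤ k)
    (hred : ∀ s, k < D.wval s → D.IsReducible k s) {t : D.N} (ht : k < D.wval t) :
    ∃ D' : TreeCutDecomp G, D'.maxAdh ≤ k ∧ (∀ s, k < D'.wval s → D'.IsReducible k s) ∧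
      D'.excess k < D.excess k := by
  obtain ⟨ℛ, hℛ, helim, hcard⟩ := hred t ht
  obtain ⟨b, hb, 𝒴, h𝒴ℛ, hb𝒴, hthin, hcut, helim'⟩ :=
    helim.exists_merge (D.pairwiseDisjoint_neighborSides t) hℛ (exists_bold_mem hcard ht)
  obtain ⟨x₀, hx₀, hx₀b⟩ := hℛ (h𝒴ℛ hb𝒴)
  change D.side x₀ t = b at hx₀b
  let Y : Set D.N := {y | D.T.Adj t y ∧ D.side y t ∈ 𝒴}
  have hY : ∀ y ∈ Y, D.T.Adj t y := fun y hy => hy.1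
  have hU : ⋃ y ∈ Y, D.side y t = ⋃₀ 𝒴 := by
    ext v
    simp only [Set.mem_iUnion, Set.mem_sUnion, exists_prop]
    constructor
    · rintro ⟨y, hy, hv⟩
      exact ⟨_, hy.2, hv⟩
    · rintro ⟨S, hS, hv⟩
      obtain ⟨y, hy, rfl⟩ := hℛ (h𝒴ℛ hS)
      exact ⟨y, ⟨hy, hS⟩, hv⟩
  have hrest : (fun x => D.side x t) '' {x | D.T.Adj t x ∧ x ∉ Y} = D.neighborSides t \ 𝒴 := by
    ext S
    constructor
    · rintro ⟨x, ⟨hx, hxY⟩, rfl⟩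
      exact ⟨⟨x, hx, rfl⟩, fun h => hxY ⟨hx, h⟩⟩
    · rintro ⟨⟨x, hx, rfl⟩, h⟩
      exact ⟨x, ⟨hx, fun hxY => h hxY.2⟩, rfl⟩
  have hcutU : G.cutSize (⋃ y ∈ Y, D.side y t) ≤ 2 := by rwa [hU]
  have hx₀bold : x₀ ∈ D.boldNeighbors t := D.mem_boldNeighbors_iff.2 ⟨hx₀, by rwa [hx₀b]⟩
  have hx₀Y : x₀ ∈ Y := ⟨hx₀, by rwa [hx₀b]⟩
  have hk : 3 ≤ k := (hx₀bold.2).trans_le (D.maxAdh_le_iff.1 hadh _ _ hx₀)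
  have hwt : (D.splitNode t Y hY).wval (some t) < D.wval t := by
    refine Nat.add_lt_add_left ?_ (D.bag t).card
    calc ((D.splitNode t Y hY).boldNeighbors (some t)).ncard
        ≤ (some '' (D.boldNeighbors t \ Y)).ncard :=
          Set.ncard_le_ncard (boldNeighbors_splitNode_self hcutU)
      _ ≤ (D.boldNeighbors t \ Y).ncard := Set.ncard_image_le
      _ < (D.boldNeighbors t).ncard := Set.ncard_lt_ncard
          (Set.ssubset_iff_of_subset Set.sdiff_subset |>.2 ⟨x₀, hx₀bold, fun h => h.2 hx₀Y⟩)
  have hwn : (D.splitNode t Y hY).wval none ≤ k := by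
    have h0 : ((D.splitNode t Y hY).bag none).card = 0 := rfl
    rw [wval_eq, h0, zero_add]
    refine le_trans ?_ (show 1 ≤ k by omega)
    refine (Set.ncard_le_ncard ((boldNeighbors_splitNode_none hcutU).trans
      (Set.image_mono (t := {x₀}) ?_))).trans (by simp)
    rintro x ⟨hx, hxY⟩
    rw [mem_boldNeighbors_iff] at hx
    have hxb : D.side x t = b := by
      by_contra hne
      have := hthin _ hxY.2 hne
      omega
    exact D.eq_of_side_eq hx.1 hx₀ hx.2 (hxb.trans hx₀b.symm)
  refine ⟨D.splitNode t Y hY, maxAdh_splitNode_le hadh (hcutU.trans (by omega)), ?_, ?_⟩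
  · rintro (_ | s) hs
    · exact absurd hs hwn.not_gt
    by_cases hst : s = t
    · subst hst
      refine ⟨insert (⋃₀ 𝒴) (ℛ \ 𝒴), ?_, helim', ?_⟩
      · rw [neighborSides_splitNode_self, hU, hrest]
        exact Set.insert_subset_insert (Set.sdiff_subset_sdiff_left hℛ)
      · refine le_trans (Nat.add_le_add_left (Set.ncard_le_ncard ?_) _) hcard
        rw [neighborSides_splitNode_self, hU, hrest]
        rintro S ⟨rfl | hS, hS'⟩
        · exact absurd (Set.mem_insert _ _) hS'
        · exact ⟨hS.1, fun h => hS' (Or.inr ⟨h, hS.2⟩)⟩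
    · obtain ⟨ℛ', h1, h2, h3⟩ := hred s (hs.trans_le (wval_splitNode_of_ne hst))
      refine ⟨ℛ', ?_, h2, ?_⟩
      · rwa [neighborSides_splitNode_of_ne hst]
      · rwa [neighborSides_splitNode_of_ne hst]
  · rw [excess_splitNode, Nat.sub_eq_zero_of_le hwn, zero_add]
    refine Finset.sum_lt_sum (fun s _ => ?_) ⟨t, Finset.mem_univ _, by omega⟩
    by_cases hst : s = t
    · subst hst
      exact Nat.sub_le_sub_right hwt.le k
    · exact Nat.sub_le_sub_right (wval_splitNode_of_ne hst) k

lemma exists_width'_le {k : ℕ} (D : TreeCutDecomp G) (hadh : D.maxAdh ≤ k)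
    (hred : ∀ s, k < D.wval s → D.IsReducible k s) :
    ∃ D' : TreeCutDecomp G, D'.width' ≤ k := by
  induction hn : D.excess k using Nat.strong_induction_on generalizing D with
  | _ n ih =>
    by_cases h : ∃ t, k < D.wval t
    · obtain ⟨t, ht⟩ := h
      obtain ⟨D', h1, h2, h3⟩ := exists_excess_lt hadh hred ht
      exact ih _ (hn ▸ h3) D' h1 h2 rfl
    · push Not at h
      exact ⟨D, max_le hadh (Finset.sup_le fun t _ => h t)⟩

end TreeCutDecomp
namespace Multigraph

variable {G H : Multigraph}

lemma cutSize_singleton_le_degree (v : G.V) : G.cutSize {v} ≤ G.degree v := by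
  refine Set.ncard_le_ncard ?_
  rintro e ⟨a, b, he, rfl, -⟩
  change a ∈ G.ends e
  simp [he]

lemma mem_edgeBoundary_of_map {φ : H.V → G.V} {A : Set H.V} {C : Set G.V}
    (hC : ∀ w, φ w ∈ C ↔ w ∈ A) {e : H.E} {x y : G.V} (he : Sym2.map φ (H.ends e) = s(x, y))
    (hx : x ∈ C) (hy : y ∉ C) : e ∈ H.edgeBoundary A := by
  obtain ⟨⟨u, v⟩, huv⟩ := Sym2.mk_surjective (H.ends e)
  rw [← huv] at he
  change s(φ u, φ v) = s(x, y) at he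
  rw [mem_edgeBoundary_iff huv.symm, ← hC, ← hC]
  rw [Sym2.eq_iff] at he
  rcases he with ⟨rfl, rfl⟩ | ⟨rfl, rfl⟩
  · exact Or.inl ⟨hx, hy⟩
  · exact Or.inr ⟨hx, hy⟩

lemma cutSize_le_of_subset_image {A : Set H.V} {C : Set G.V} (g : H.E → G.E)
    (h : G.edgeBoundary C ⊆ g '' H.edgeBoundary A) : G.cutSize C ≤ H.cutSize A :=
  (Set.ncard_le_ncard h).trans Set.ncard_image_le

end Multigraph

/-- The relation between the vertices of a marked graph and those of the marked graph obtained by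
suppressing the peripheral vertex `z`. -/
structure SuppressionMap (M M' : MarkedGraph) (z : M.G.V) (φ : M'.G.V → M.G.V) : Prop where
  notMem_core : z ∉ M.core
  degree_le_two : M.G.degree z ≤ 2
  injective : Function.Injective φ
  range_eq : Set.range φ = {z}ᶜ
  mem_core_iff : ∀ w, w ∈ M'.core ↔ φ w ∈ M.core
  degree_le : ∀ w, M'.G.degree w ≤ M.G.degree (φ w)
  cutSize_le : ∀ A, M.G.cutSize (φ '' A) ≤ M'.G.cutSize A ∨
    M.G.cutSize (insert z (φ '' A)) ≤ M'.G.cutSize A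

lemma Suppresses.exists_suppressionMap {M M' : MarkedGraph} (h : Suppresses M M') :
    ∃ z φ, SuppressionMap M M' z φ := by
  obtain ⟨z, hz, hdeg, fV, hcore, hE⟩ := h
  let φ : M'.G.V → M.G.V := fun w => (fV w).1
  have hφz : ∀ w, φ w ≠ z := fun w => (fV w).2
  have hinj : Function.Injective φ := Subtype.val_injective.comp fV.injective
  have hrange : Set.range φ = {z}ᶜ := by
    ext v
    constructor
    · rintro ⟨w, rfl⟩
      exact hφz w
    · intro hv
      exact ⟨fV.symm ⟨v, hv⟩, by simp [φ]⟩
  have hmem : ∀ A w, φ w ∈ φ '' A ↔ w ∈ A := fun A w => hinj.mem_set_image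
  have hmem' : ∀ A w, φ w ∈ insert z (φ '' A) ↔ w ∈ A := fun A w => by
    rw [Set.mem_insert_iff, hmem, or_iff_right (hφz w)]
  have hzA : ∀ A, z ∉ φ '' A := by
    rintro A ⟨w, -, hw⟩
    exact hφz w hw
  refine ⟨z, φ, hz, hdeg, hinj, hrange, hcore, ?_, ?_⟩
  · intro w
    rcases hE with ⟨-, fE, hfE⟩ | ⟨a, b, hab, ⟨e₁, e₂, he, he₁, he₂, -⟩, fE, hfE⟩
    · refine Set.ncard_le_ncard_of_injOn (fun e => (fE e).1) ?_
        (Subtype.val_injective.comp fE.injective).injOn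
      intro e hew
      change φ w ∈ M.G.ends (fE e).1
      rw [← hfE]
      exact Sym2.mem_map.2 ⟨w, hew, rfl⟩
    · have hz₁ : z ∈ M.G.ends e₁ := by simp [he₁]
      have hz₂ : z ∈ M.G.ends e₂ := by simp [he₂]
      refine Set.ncard_le_ncard_of_injOn
        (fun e => Sum.elim Subtype.val (fun _ => if φ w = a then e₁ else e₂) (fE e)) ?_ ?_
      · intro e hew
        have hmap : φ w ∈ Sym2.map φ (M'.G.ends e) := Sym2.mem_map.2 ⟨w, hew, rfl⟩
        change φ w ∈ M.G.ends _
        rw [hfE] at hmap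
        cases hfe : fE e with
        | inl e' => simpa [hfe] using hmap
        | inr u =>
          simp only [hfe, Sum.elim_inr, Sym2.mem_iff] at hmap ⊢
          split_ifs with hwa
          · simp [he₁, hwa]
          · simp [he₂, hmap.resolve_left hwa]
      · intro e _ e' _ hee'
        apply fE.injective
        simp only at hee'
        cases hfe : fE e with
        | inl x =>
          cases hfe' : fE e' with
          | inl y =>
            rw [hfe, hfe'] at hee'
            exact congrArg _ (Subtype.ext hee')
          | inr y =>
            rw [hfe, hfe'] at hee'
            simp only [Sum.elim_inl, Sum.elim_inr] at hee'
            exact absurd (by rw [hee']; split_ifs <;> assumption) x.2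
        | inr x =>
          cases hfe' : fE e' with
          | inl y =>
            rw [hfe, hfe'] at hee'
            simp only [Sum.elim_inl, Sum.elim_inr] at hee'
            exact absurd (by rw [← hee']; split_ifs <;> assumption) y.2
          | inr y => rfl
  · intro A
    rcases hE with ⟨hpair, fE, hfE⟩ | ⟨a, b, hab, ⟨e₁, e₂, he, he₁, he₂, hall⟩, fE, hfE⟩
    · have key : ∀ C, (∀ w, φ w ∈ C ↔ w ∈ A) → (∀ e, z ∈ M.G.ends e → e ∉ M.G.edgeBoundary C) →
          M.G.cutSize C ≤ M'.G.cutSize A := by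
        intro C hC hzC
        refine cutSize_le_of_subset_image (fun e => (fE e).1) fun e heC => ?_
        have hze : z ∉ M.G.ends e := fun h => hzC e h heC
        refine ⟨fE.symm ⟨e, hze⟩, ?_, by simp⟩
        obtain ⟨x, y, hxy, hx, hy⟩ := heC
        exact mem_edgeBoundary_of_map hC ((hfE _).trans (by simpa using hxy)) hx hy
      by_cases hnb : ∃ e a, M.G.ends e = s(z, a) ∧ a ∈ φ '' A
      · right
        refine key _ (hmem' A) fun e hze heC => ?_
        obtain ⟨e', a, he', ha⟩ := hnb
        obtain ⟨b, hb⟩ := Sym2.mem_iff_exists.1 hze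
        rw [mem_edgeBoundary_iff hb] at heC
        have hbA : b ∉ φ '' A := fun h => by
          have h' : b ∈ insert z (φ '' A) := Or.inr h
          have hz' := Set.mem_insert z (φ '' A)
          tauto
        have hab : a ≠ b := by
          rintro rfl
          exact hbA ha
        have hee : e' ≠ e := by
          rintro rfl
          rw [he', Sym2.congr_right] at hb
          exact hab hb
        refine hpair ⟨a, b, hab, e', e, hee, he', hb, fun f hf => ?_⟩
        by_contra! hne
        have h3 : ({f, e', e} : Set M.G.E).ncard ≤ M.G.degree z := by
          refine Set.ncard_le_ncard ?_
          rintro g (rfl | rfl | rfl)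
          · exact hf
          · change z ∈ M.G.ends g
            simp [he']
          · exact hze
        rw [Set.ncard_eq_three.2 ⟨f, e', e, hne.1, hne.2, hee, rfl⟩] at h3
        omega
      · left
        refine key _ (hmem A) fun e hze heC => hnb ?_
        obtain ⟨b, hb⟩ := Sym2.mem_iff_exists.1 hze
        rw [mem_edgeBoundary_iff hb] at heC
        have := hzA A
        exact ⟨e, b, hb, by tauto⟩
    · have key : ∀ C, (∀ w, φ w ∈ C ↔ w ∈ A) →
          (e₁ ∈ M.G.edgeBoundary C → a ∈ C ∧ b ∉ C) → (e₂ ∈ M.G.edgeBoundary C → b ∈ C ∧ a ∉ C) →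
          M.G.cutSize C ≤ M'.G.cutSize A := by
        intro C hC h₁ h₂
        refine cutSize_le_of_subset_image
          (fun e => Sum.elim Subtype.val (fun _ => if a ∈ C then e₁ else e₂) (fE e))
          fun e heC => ?_
        have hnew : Sym2.map φ (M'.G.ends (fE.symm (Sum.inr ()))) = s(a, b) :=
          (hfE _).trans (by simp)
        by_cases hze : z ∈ M.G.ends e
        · rcases hall e hze with rfl | rfl
          · obtain ⟨ha, hb⟩ := h₁ heC
            exact ⟨fE.symm (Sum.inr ()), mem_edgeBoundary_of_map hC hnew ha hb, by simp [ha]⟩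
          · obtain ⟨hb, ha⟩ := h₂ heC
            exact ⟨fE.symm (Sum.inr ()),
              mem_edgeBoundary_of_map hC (hnew.trans Sym2.eq_swap) hb ha, by simp [ha]⟩
        · refine ⟨fE.symm (Sum.inl ⟨e, hze⟩), ?_, by simp⟩
          obtain ⟨x, y, hxy, hx, hy⟩ := heC
          exact mem_edgeBoundary_of_map hC ((hfE _).trans (by simpa using hxy)) hx hy
      by_cases hC : a ∈ φ '' A ∧ b ∈ φ '' A
      · right
        have ha : a ∈ insert z (φ '' A) := Or.inr hC.1
        have hb : b ∈ insert z (φ '' A) := Or.inr hC.2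
        have hz' := Set.mem_insert z (φ '' A)
        refine key _ (hmem' A) (fun h => ?_) (fun h => ?_)
        · rw [mem_edgeBoundary_iff he₁] at h
          tauto
        · rw [mem_edgeBoundary_iff he₂] at h
          tauto
      · left
        have hz' := hzA A
        refine key _ (hmem A) (fun h => ?_) (fun h => ?_)
        · rw [mem_edgeBoundary_iff he₁] at h
          tauto
        · rw [mem_edgeBoundary_iff he₂] at h
          tauto

/-- The relation between the vertices of a marked graph and those of a marked graph obtained by
repeatedly suppressing peripheral vertices of degree at most two. -/
structure ReductionMap (M₀ M : MarkedGraph) (φ : M.G.V → M₀.G.V) : Prop where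
  injective : Function.Injective φ
  core_subset : M₀.core ⊆ Set.range φ
  mem_core_iff : ∀ w, w ∈ M.core ↔ φ w ∈ M₀.core
  degree_le : ∀ w, M.G.degree w ≤ M₀.G.degree (φ w)
  exists_cutSize_le : ∀ A, ∃ Z ⊆ (Set.range φ)ᶜ, M₀.G.cutSize (φ '' A ∪ Z) ≤ M.G.cutSize A
  eliminable : ∀ Q ⊂ (Set.range φ)ᶜ, ∃ z ∉ Set.range φ, z ∉ Q ∧
    ∃ Y ⊆ insert z Q, z ∈ Y ∧ M₀.G.cutSize Y ≤ 2

lemma ReductionMap.comp {M₀ M M' : MarkedGraph} {φ : M.G.V → M₀.G.V} (hφ : ReductionMap M₀ M φ)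
    {z : M.G.V} {ψ : M'.G.V → M.G.V} (hψ : SuppressionMap M M' z ψ) :
    ReductionMap M₀ M' (φ ∘ ψ) := by
  have hcompl : (Set.range (φ ∘ ψ))ᶜ = insert (φ z) (Set.range φ)ᶜ := by
    rw [Set.range_comp, hψ.range_eq, Set.image_compl_eq_range_sdiff_image hφ.injective]
    ext v
    simp only [Set.image_singleton, Set.mem_compl_iff, Set.mem_sdiff, Set.mem_singleton_iff,
      Set.mem_insert_iff]
    tauto
  refine ⟨hφ.injective.comp hψ.injective, ?_, ?_, ?_, ?_, ?_⟩
  · intro v hv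
    obtain ⟨w, rfl⟩ := hφ.core_subset hv
    have hw : w ∈ Set.range ψ := by
      rw [hψ.range_eq]
      rintro rfl
      exact hψ.notMem_core ((hφ.mem_core_iff _).2 hv)
    obtain ⟨u, rfl⟩ := hw
    exact ⟨u, rfl⟩
  · intro w
    rw [hψ.mem_core_iff, hφ.mem_core_iff, Function.comp_apply]
  · exact fun w => (hψ.degree_le w).trans (hφ.degree_le _)
  · intro A
    rw [hcompl, Set.image_comp]
    rcases hψ.cutSize_le A with h | h
    · obtain ⟨Z, hZ, hZA⟩ := hφ.exists_cutSize_le (ψ '' A)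
      exact ⟨Z, hZ.trans (Set.subset_insert _ _), hZA.trans h⟩
    · obtain ⟨Z, hZ, hZA⟩ := hφ.exists_cutSize_le (insert z (ψ '' A))
      refine ⟨insert (φ z) Z, Set.insert_subset_insert hZ, le_trans (le_of_eq ?_) (hZA.trans h)⟩
      rw [Set.image_insert_eq, Set.insert_union, Set.union_insert]
  · intro Q hQ
    rw [hcompl] at hQ
    have hmem : ∀ v, v ∉ Set.range (φ ∘ ψ) ↔ v = φ z ∨ v ∉ Set.range φ := fun v => by
      rw [← Set.mem_compl_iff, hcompl]
      rfl
    by_cases hRQ : (Set.range φ)ᶜ ⊆ Q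
    · obtain ⟨Z, hZ, hZz⟩ := hφ.exists_cutSize_le {z}
      refine ⟨φ z, (hmem _).2 (Or.inl rfl), fun h => hQ.2 (Set.insert_subset h hRQ),
        insert (φ z) Z, Set.insert_subset_insert (hZ.trans hRQ), Set.mem_insert _ _, ?_⟩
      rw [Set.image_singleton, Set.singleton_union] at hZz
      exact hZz.trans ((cutSize_singleton_le_degree z).trans hψ.degree_le_two)
    · obtain ⟨y, hy, hyQ, Y, hYQ, hyY, hY⟩ := hφ.eliminable (Q ∩ (Set.range φ)ᶜ)
        ⟨Set.inter_subset_right, fun h => hRQ fun v hv => (h hv).1⟩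
      exact ⟨y, (hmem y).2 (Or.inr hy), fun h => hyQ ⟨h, hy⟩, Y,
        hYQ.trans (Set.insert_subset_insert Set.inter_subset_left), hyY, hY⟩

lemma exists_reductionMap {M₀ M : MarkedGraph} (h : Relation.ReflTransGen Suppresses M₀ M) :
    ∃ φ, ReductionMap M₀ M φ := by
  induction h with
  | refl =>
    refine ⟨id, Function.injective_id, by simp, fun _ => Iff.rfl, fun _ => le_rfl,
      fun A => ⟨∅, by simp, by simp⟩, fun Q hQ => ?_⟩
    simp [Set.ssubset_iff_subset_ne, Set.subset_empty_iff] at hQ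
  | tail _ hs ih =>
    obtain ⟨φ, hφ⟩ := ih
    obtain ⟨z, ψ, hψ⟩ := hs.exists_suppressionMap
    exact ⟨_, hφ.comp hψ⟩

lemma Sym2.exists_map_val_eq {α : Type} {z : α} {p : Sym2 α} (hp : z ∉ p) :
    ∃ q : Sym2 {v : α // v ≠ z}, q.map Subtype.val = p := by
  induction p using Sym2.ind with
  | _ x y =>
    rw [Sym2.mem_iff, not_or] at hp
    exact ⟨s(⟨x, Ne.symm hp.1⟩, ⟨y, Ne.symm hp.2⟩), rfl⟩

/-- A marked graph on the vertices other than `z` whose edges have prescribed ends. -/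
lemma exists_markedGraph (M : MarkedGraph) (z : M.G.V) {E : Type} [Finite E]
    (f : E → Sym2 M.G.V) (hz : ∀ e, z ∉ f e) (hf : ∀ e, ¬ (f e).IsDiag) :
    ∃ (M' : MarkedGraph) (fV : M'.G.V ≃ {v : M.G.V // v ≠ z}) (fE : M'.G.E ≃ E),
      (∀ w, w ∈ M'.core ↔ (fV w).1 ∈ M.core) ∧
      ∀ e, Sym2.map (fun w => (fV w).1) (M'.G.ends e) = f (fE e) := by
  choose g hg using fun e => Sym2.exists_map_val_eq (hz e)
  refine ⟨⟨⟨{v : M.G.V // v ≠ z}, E, Fintype.ofFinite _, Fintype.ofFinite _, g, fun e h => ?_⟩,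
    {w | w.1 ∈ M.core}⟩, Equiv.refl _, Equiv.refl _, fun _ => Iff.rfl, hg⟩
  exact hf e (hg e ▸ h.map)

lemma exists_suppresses {M : MarkedGraph} (h : ¬ M.Terminal) : ∃ M', Suppresses M M' := by
  simp only [MarkedGraph.Terminal, not_forall, not_lt] at h
  obtain ⟨z, hz, hdeg⟩ := h
  by_cases hpair : ∃ a b : M.G.V, a ≠ b ∧ SuppPair M.G z a b
  · obtain ⟨a, b, hab, hs⟩ := hpair
    obtain ⟨M', fV, fE, hcore, hE⟩ := exists_markedGraph M z
      (E := {e : M.G.E // z ∉ M.G.ends e} ⊕ Unit)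
      (Sum.elim (fun e => M.G.ends e.1) (fun _ => s(a, b)))
      (by
        obtain ⟨e₁, e₂, -, he₁, he₂, -⟩ := hs
        rintro (e | _)
        · exact e.2
        · have h1 := M.G.loopless e₁
          have h2 := M.G.loopless e₂
          rw [he₁, Sym2.mk_isDiag_iff] at h1
          rw [he₂, Sym2.mk_isDiag_iff] at h2
          simp [h1, h2])
      (by
        rintro (e | _)
        · exact M.G.loopless e.1
        · simpa using hab)
    exact ⟨M', z, hz, hdeg, fV, hcore, Or.inr ⟨a, b, hab, hs, fE, hE⟩⟩
  · obtain ⟨M', fV, fE, hcore, hE⟩ := exists_markedGraph M z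
      (E := {e : M.G.E // z ∉ M.G.ends e}) (fun e => M.G.ends e.1) (fun e => e.2)
      (fun e => M.G.loopless e.1)
    exact ⟨M', z, hz, hdeg, fV, hcore, Or.inl ⟨hpair, fE, hE⟩⟩

lemma exists_terminal (M : MarkedGraph) :
    ∃ M', Relation.ReflTransGen Suppresses M M' ∧ M'.Terminal := by
  induction hn : Fintype.card M.G.V using Nat.strong_induction_on generalizing M with
  | _ n ih =>
    by_cases h : M.Terminal
    · exact ⟨M, .refl, h⟩
    · obtain ⟨M₁, h₁⟩ := exists_suppresses h
      have hlt : Fintype.card M₁.G.V < n := by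
        obtain ⟨z, ψ, hψ⟩ := h₁.exists_suppressionMap
        rw [← hn]
        refine Fintype.card_lt_of_injective_of_notMem ψ hψ.injective (b := z) ?_
        rw [hψ.range_eq]
        simp
      obtain ⟨M', h', hM'⟩ := ih _ hlt M₁ rfl
      exact ⟨M', h'.head h₁, hM'⟩
namespace TreeCutDecomp

variable {G : Multigraph} (D : TreeCutDecomp G) {t : D.N}

lemma torsoProj_of_mem_bag {v : G.V} (h : v ∈ D.bag t) :
    D.torsoProj t v = some (Sum.inl ⟨v, h⟩) :=
  dif_pos h

lemma torsoProj_of_mem_side {v : G.V} (x : {x : D.N // D.T.Adj t x}) (h : v ∈ D.side x t) :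
    D.torsoProj t v = some (Sum.inr x) := by
  have hb : v ∉ D.bag t := fun hb => D.notMem_side_of_mem_bag x.2 hb h
  have hx : ∃ y : {x : D.N // D.T.Adj t x},
      (D.T.deleteEdges {e : Sym2 D.N | t ∈ e}).Reachable (D.nodeOf v) y.1 :=
    ⟨x, (D.mem_side_iff x.2).1 h⟩
  rw [torsoProj, dif_neg hb, dif_pos hx]
  exact congrArg _ (congrArg _ (Subtype.ext (D.eq_of_mem_side hx.choose.2 x.2
    ((D.mem_side_iff hx.choose.2).2 hx.choose_spec) h)))

lemma torsoProj_eq_inr_iff {v : G.V} (x : {x : D.N // D.T.Adj t x}) :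
    D.torsoProj t v = some (Sum.inr x) ↔ v ∈ D.side x t := by
  refine ⟨fun h => ?_, D.torsoProj_of_mem_side x⟩
  rw [torsoProj] at h
  split_ifs at h with h₁ h₂
  · cases h
  · cases h
    exact (D.mem_side_iff h₂.choose.2).2 h₂.choose_spec

lemma exists_torsoProj_eq_some {v : G.V} (h : D.T.Reachable (D.nodeOf v) t) :
    ∃ b, D.torsoProj t v = some b := by
  rcases D.mem_bag_or_exists_mem_side h with h | ⟨x, hx, h⟩
  · exact ⟨_, D.torsoProj_of_mem_bag h⟩
  · exact ⟨_, D.torsoProj_of_mem_side ⟨x, hx⟩ h⟩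

lemma map_torsoProj_ends (e : (D.torsoGraph t).E) :
    Sym2.map (D.torsoProj t) (G.ends e.1) = Sym2.map some ((D.torsoGraph t).ends e) :=
  e.2.choose_spec.choose_spec.2

lemma degree_torsoGraph_le (x : {x : D.N // D.T.Adj t x}) :
    (D.torsoGraph t).degree (Sum.inr x : D.TorsoV t) ≤ G.cutSize (D.side x t) := by
  refine Set.ncard_le_ncard_of_injOn Subtype.val ?_ Subtype.val_injective.injOn
  intro e he
  change (Sum.inr x : D.TorsoV t) ∈ (D.torsoGraph t).ends e at he
  have hloop := sym2_map_not_isDiag (Option.some_injective _) ((D.torsoGraph t).loopless e)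
  have hmem : some (Sum.inr x) ∈ Sym2.map some ((D.torsoGraph t).ends e) :=
    Sym2.mem_map.2 ⟨_, he, rfl⟩
  rw [← D.map_torsoProj_ends] at hloop hmem
  obtain ⟨⟨u, v⟩, huv⟩ := Sym2.mk_surjective (G.ends e.1)
  rw [← huv] at hloop hmem
  change ¬ (s(D.torsoProj t u, D.torsoProj t v)).IsDiag at hloop
  change some (Sum.inr x) ∈ s(D.torsoProj t u, D.torsoProj t v) at hmem
  rw [Sym2.mk_isDiag_iff] at hloop
  rw [mem_edgeBoundary_iff huv.symm, ← torsoProj_eq_inr_iff, ← torsoProj_eq_inr_iff]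
  rcases Sym2.mem_iff.1 hmem with h | h
  · exact Or.inl ⟨h.symm, fun h' => hloop (h.symm.trans h'.symm)⟩
  · exact Or.inr ⟨h.symm, fun h' => hloop (h'.trans h)⟩

lemma cutSize_iUnion_side_le (Y : Set {x : D.N // D.T.Adj t x}) :
    G.cutSize (⋃ x ∈ Y, D.side x t) ≤
      (D.torsoGraph t).cutSize (Sum.inr '' Y : Set (D.TorsoV t)) := by
  refine cutSize_le_of_subset_image (H := D.torsoGraph t) Subtype.val ?_
  rintro e ⟨u, v, he, hu, hv⟩
  simp only [Set.mem_iUnion, exists_prop] at hu hv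
  obtain ⟨x, hxY, hu⟩ := hu
  have hut := D.torsoProj_of_mem_side x hu
  have hreach : D.T.Reachable (D.nodeOf v) t :=
    (D.reachable_nodeOf he).symm.trans ((D.reachable_of_mem_side hu).trans x.2.symm.reachable)
  obtain ⟨b, hvt⟩ := D.exists_torsoProj_eq_some hreach
  have hb : b ∉ (Sum.inr '' Y : Set (D.TorsoV t)) := by
    rintro ⟨y, hy, rfl⟩
    exact hv ⟨y, hy, (D.torsoProj_eq_inr_iff y).1 hvt⟩
  have hxb : (Sum.inr x : D.TorsoV t) ≠ b := by
    rintro rfl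
    exact hb ⟨x, hxY, rfl⟩
  have hmap : Sym2.map (D.torsoProj t) (G.ends e) = s(some (Sum.inr x), some b) := by
    rw [he, Sym2.map_mk, hut, hvt]
    rfl
  let e' : (D.torsoGraph t).E := ⟨e, Sum.inr x, b, hxb, hmap⟩
  refine ⟨e', ⟨Sum.inr x, b, ?_, ⟨x, hxY, rfl⟩, hb⟩, rfl⟩
  exact Sym2.map.injective (Option.some_injective _) ((D.map_torsoProj_ends e').symm.trans hmap)

lemma ncard_range_inl_union (P : Set {x : D.N // D.T.Adj t x}) :
    (Set.range Sum.inl ∪ Sum.inr '' P : Set (D.TorsoV t)).ncard = (D.bag t).card + P.ncard := by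
  have h := Set.ncard_union_eq (s := Set.range (Sum.inl : {v : G.V // v ∈ D.bag t} → _))
    (t := Sum.inr '' P) (by
      rw [Set.disjoint_left]
      rintro _ ⟨b, rfl⟩ ⟨x, -, hx⟩
      cases hx) (Set.toFinite _) (Set.toFinite _)
  rw [Set.ncard_range_of_injective Sum.inl_injective,
    Set.ncard_image_of_injective _ Sum.inr_injective, Nat.card_eq_fintype_card,
    Fintype.card_coe] at h
  exact h

lemma threeCenterSizes_le_wval {n : ℕ} (hn : n ∈ D.threeCenterSizes t) : n ≤ D.wval t := by
  obtain ⟨M, hM, hterm, rfl⟩ := hn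
  obtain ⟨φ, hφ⟩ := exists_reductionMap hM
  let B : Set (D.TorsoV t) := Set.range Sum.inl ∪ Sum.inr '' {x | x.1 ∈ D.boldNeighbors t}
  have hB : Set.range φ ⊆ B := by
    rintro _ ⟨w, rfl⟩
    by_cases hw : φ w ∈ (D.torso t).core
    · exact Or.inl hw
    · have hdeg := (hterm w fun h => hw ((hφ.mem_core_iff w).1 h)).trans_le (hφ.degree_le w)
      generalize φ w = b at hw hdeg
      rcases b with b | x
      · exact absurd ⟨b, rfl⟩ hw
      · exact Or.inr ⟨x, D.mem_boldNeighbors_iff.2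
          ⟨x.2, hdeg.trans_le (D.degree_torsoGraph_le x)⟩, rfl⟩
  rw [← Nat.card_eq_fintype_card, ← Set.ncard_range_of_injective hφ.injective]
  refine (Set.ncard_le_ncard hB (Set.toFinite _)).trans ((D.ncard_range_inl_union _).le.trans ?_)
  exact Nat.add_le_add_left (Set.ncard_le_ncard_of_injOn Subtype.val (fun x hx => hx)
    Subtype.val_injective.injOn (Set.toFinite _)) _

lemma width_le_width' : D.width ≤ D.width' := by
  refine max_le_max le_rfl (Finset.sup_mono_fun fun t _ => ?_)
  exact csSup_le' fun n hn => D.threeCenterSizes_le_wval hn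

lemma isReducible_width (t : D.N) : D.IsReducible D.width t := by
  obtain ⟨M, hM, hterm⟩ := exists_terminal (D.torso t)
  obtain ⟨φ, hφ⟩ := exists_reductionMap hM
  have hcompl : ∀ b ∉ Set.range φ, ∃ x, b = Sum.inr x := by
    rintro (b | x) hb
    · exact absurd (hφ.core_subset ⟨b, rfl⟩) hb
    · exact ⟨x, rfl⟩
  let S : D.TorsoV t → Set G.V := Sum.elim (fun _ => ∅) (fun x => D.side x t)
  have hS : ∀ Y : Set (D.TorsoV t), Y ⊆ (Set.range φ)ᶜ →
      G.cutSize (⋃₀ (S '' Y)) ≤ (D.torsoGraph t).cutSize Y := by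
    intro Y hY
    have hYx : Y = (Sum.inr '' {x : {x : D.N // D.T.Adj t x} |
        (Sum.inr x : D.TorsoV t) ∈ Y} : Set (D.TorsoV t)) := by
      ext b
      constructor
      · intro hb
        obtain ⟨x, rfl⟩ := hcompl b (hY hb)
        exact ⟨x, hb, rfl⟩
      · rintro ⟨x, hx, rfl⟩
        exact hx
    have h := D.cutSize_iUnion_side_le {x | (Sum.inr x : D.TorsoV t) ∈ Y}
    rw [← hYx] at h
    refine le_of_eq_of_le ?_ h
    congr 1
    ext v
    rw [Set.mem_sUnion, Set.mem_iUnion₂]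
    constructor
    · rintro ⟨_, ⟨b, hb, rfl⟩, hv⟩
      obtain ⟨x, rfl⟩ := hcompl b (hY hb)
      exact ⟨x, hb, hv⟩
    · rintro ⟨x, hx, hv⟩
      exact ⟨_, ⟨Sum.inr x, hx, rfl⟩, hv⟩
  refine ⟨S '' (Set.range φ)ᶜ, ?_, ?_, ?_⟩
  · rintro _ ⟨b, hb, rfl⟩
    obtain ⟨x, rfl⟩ := hcompl b hb
    exact ⟨x, x.2, rfl⟩
  · intro Q hQ
    obtain ⟨z, hz, hzQ, Y, hYQ, hzY, hY⟩ := hφ.eliminable {b | b ∉ Set.range φ ∧ S b ∈ Q} (by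
      refine ⟨fun b hb => hb.1, fun h => hQ.2 ?_⟩
      rintro _ ⟨b, hb, rfl⟩
      exact (h hb).2)
    refine ⟨S z, ⟨z, hz, rfl⟩, fun h => hzQ ⟨hz, h⟩, S '' Y, ?_, ⟨z, hzY, rfl⟩,
      (hS Y fun b hb => ?_).trans hY⟩
    · rintro _ ⟨b, hb, rfl⟩
      rcases hYQ hb with rfl | hb
      · exact Or.inl rfl
      · exact Or.inr hb.2
    · rcases hYQ hb with rfl | hb
      · exact hz
      · exact hb.1
  · have hbdd : BddAbove (D.threeCenterSizes t) :=
      ⟨D.wval t, fun n hn => D.threeCenterSizes_le_wval hn⟩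
    have hM_le : Fintype.card M.G.V ≤ D.width :=
      (le_csSup hbdd ⟨M, hM, hterm, rfl⟩).trans ((Finset.le_sup
        (f := fun s => sSup (D.threeCenterSizes s)) (Finset.mem_univ t)).trans (le_max_right _ _))
    refine le_trans ?_ hM_le
    let P : Set {x : D.N // D.T.Adj t x} := {x | (Sum.inr x : D.TorsoV t) ∈ Set.range φ}
    have hP : D.neighborSides t \ S '' (Set.range φ)ᶜ ⊆ (fun x => D.side x.1 t) '' P := by
      rintro _ ⟨⟨x, hx, rfl⟩, hxS⟩
      refine ⟨⟨x, hx⟩, ?_, rfl⟩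
      by_contra h
      exact hxS ⟨Sum.inr ⟨x, hx⟩, h, rfl⟩
    have hsub : (Set.range Sum.inl ∪ Sum.inr '' P : Set (D.TorsoV t)) ⊆ Set.range φ := by
      rintro _ (⟨b, rfl⟩ | ⟨x, hx, rfl⟩)
      · exact hφ.core_subset ⟨b, rfl⟩
      · exact hx
    rw [← Nat.card_eq_fintype_card, ← Set.ncard_range_of_injective hφ.injective]
    refine le_trans ?_ (Set.ncard_le_ncard (α := D.TorsoV t) hsub (Set.toFinite _))
    rw [D.ncard_range_inl_union]
    exact Nat.add_le_add_left ((Set.ncard_le_ncard hP (Set.toFinite _)).trans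
      (Set.ncard_image_le (Set.toFinite _))) _

lemma exists_width'_le_width : ∃ D' : TreeCutDecomp G, D'.width' ≤ D.width :=
  exists_width'_le D (le_max_left _ _) fun t _ => D.isReducible_width t

end TreeCutDecomp

/-- `tctw = tctw'`; moreover `width ≤ width'` always holds, and
from any decomposition one can compute one whose `width'` is at most the
original `width`. -/
theorem tcw_eq_tcw' (G : Multigraph) :
    tcw G = tcw' G ∧
    ∀ D : TreeCutDecomp G, D.width ≤ D.width' ∧
      ∃ D' : TreeCutDecomp G, D'.width' ≤ D.width := by
  refine ⟨?_, fun D => ⟨D.width_le_width', D.exists_width'_le_width⟩⟩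
  by_cases h : Nonempty (TreeCutDecomp G)
  · obtain ⟨D₀⟩ := h
    have h₁ : {k | ∃ D : TreeCutDecomp G, D.width = k}.Nonempty := ⟨_, D₀, rfl⟩
    have h₂ : {k | ∃ D : TreeCutDecomp G, D.width' = k}.Nonempty := ⟨_, D₀, rfl⟩
    apply le_antisymm
    · obtain ⟨D, hD⟩ := Nat.sInf_mem h₂
      rw [tcw', ← hD]
      exact le_trans (Nat.sInf_le ⟨D, rfl⟩) D.width_le_width'
    · obtain ⟨D, hD⟩ := Nat.sInf_mem h₁
      obtain ⟨D', hD'⟩ := D.exists_width'_le_width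
      rw [tcw, ← hD]
      exact le_trans (Nat.sInf_le ⟨D', rfl⟩) hD'
  · have h₁ : ∀ k, ¬ ∃ D : TreeCutDecomp G, D.width = k := fun k ⟨D, _⟩ => h ⟨D⟩
    have h₂ : ∀ k, ¬ ∃ D : TreeCutDecomp G, D.width' = k := fun k ⟨D, _⟩ => h ⟨D⟩
    simp [tcw, tcw', h₁, h₂]
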